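/- Let s be a Schur function admitting a pseudocontinuation of bounded type across an arc γ of the unit circle. Then there exists a 2×2 matrix function S = (s_ij) with all entries Schur functions, s₂₂ = s, such that the boundary values of S are unitary a.e. on γ. -/

import Mathlib

open MeasureTheory Filter Complex Set Matrix

noncomputable section

/-- The open unit disk. -/
def unitDisk : Set ℂ := {z : ℂ | ‖z‖ < 1}

/-- The exterior of the closed unit disk. -/
def extDisk : Set ℂ := {z : ℂ | 1 < ‖z‖}

/-- Point on the unit circle with angle `θ`. -/
def circlePt (θ : ℝ) : ℂ := Complex.exp (θ * Complex.I)

/-- One full period of angles, parametrizing the circle 𝕋. -/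
def circleSet : Set ℝ := Set.Ioc 0 (2 * Real.pi)

/-- `RadLim f θ w` : the radial (nontangential) boundary value of `f` (analytic in the
disk) at the boundary point `circlePt θ` exists and equals `w`. -/
def RadLim (f : ℂ → ℂ) (θ : ℝ) (w : ℂ) : Prop :=
  Filter.Tendsto (fun r : ℝ => f ((r : ℂ) * circlePt θ))
    (nhdsWithin 1 (Set.Iio 1)) (nhds w)

/-- `RadLimExt f θ w` : the radial boundary value of `f` (analytic in the exterior disk)
at the boundary point `circlePt θ`, taken from outside. -/
def RadLimExt (f : ℂ → ℂ) (θ : ℝ) (w : ℂ) : Prop :=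
  Filter.Tendsto (fun r : ℝ => f ((r : ℂ) * circlePt θ))
    (nhdsWithin 1 (Set.Ioi 1)) (nhds w)

/-- A Schur function: analytic on the unit disk and bounded by 1 in modulus. -/
def SchurFn (f : ℂ → ℂ) : Prop :=
  DifferentiableOn ℂ f unitDisk ∧ ∀ z ∈ unitDisk, ‖f z‖ ≤ 1

/-- The Nevanlinna class on a domain `Ω` : quotients of two bounded (contractive)
analytic functions, with not-identically-zero denominator. -/
def NevOn (Ω : Set ℂ) (f : ℂ → ℂ) : Prop :=
  ∃ f₁ f₂ : ℂ → ℂ, DifferentiableOn ℂ f₁ Ω ∧ DifferentiableOn ℂ f₂ Ω ∧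
    (∀ z ∈ Ω, ‖f₁ z‖ ≤ 1) ∧ (∀ z ∈ Ω, ‖f₂ z‖ ≤ 1) ∧
    (∃ z ∈ Ω, f₂ z ≠ 0) ∧ (∀ z ∈ Ω, f₂ z ≠ 0 → f z = f₁ z / f₂ z)

/-- An arc of the unit circle, described by its set of angles (one full period is
`Set.Ioo 0 (2π)` up to a null set, so the case γ = 𝕋 is not excluded). -/
def IsArc (γ : Set ℝ) : Prop :=
  ∃ a b : ℝ, 0 ≤ a ∧ a < b ∧ b ≤ 2 * Real.pi ∧ γ = Set.Ioo a b

/-- `f` admits a pseudocontinuation of bounded type across the arc with angle set `γ` :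
there is a Nevanlinna function on the exterior disk whose boundary values agree with
those of `f` a.e. on `γ`. -/
def PCArc (f : ℂ → ℂ) (γ : Set ℝ) : Prop :=
  ∃ ft : ℂ → ℂ, NevOn extDisk ft ∧
    ∀ᵐ θ ∂(volume.restrict γ), ∃ w : ℂ, RadLim f θ w ∧ RadLimExt ft θ w

/-- The boundary values of `f` exist and are unimodular a.e. on `γ`. -/
def UnimodularAEOn (f : ℂ → ℂ) (γ : Set ℝ) : Prop :=
  ∀ᵐ θ ∂(volume.restrict γ), ∃ w : ℂ, RadLim f θ w ∧ ‖w‖ = 1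

/-- The boundary values of the 2×2 matrix function `S` exist and are unitary a.e. on `γ`. -/
def UnitaryAEOn (S : ℂ → Matrix (Fin 2) (Fin 2) ℂ) (γ : Set ℝ) : Prop :=
  ∀ᵐ θ ∂(volume.restrict γ), ∃ W : Matrix (Fin 2) (Fin 2) ℂ,
    (∀ i j, RadLim (fun z => S z i j) θ (W i j)) ∧ Wᴴ * W = 1

/-- An outer function on the unit disk (normalized, with multiplicative constant 1):
`f z = exp (∫_𝕋 (t+z)/(t-z) φ(t) dm(t))` for some real integrable boundary data `φ`,
`m` being normalized Lebesgue measure on 𝕋. -/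
def IsOuter (f : ℂ → ℂ) : Prop :=
  ∃ φ : ℝ → ℝ, IntegrableOn φ circleSet ∧
    ∀ z ∈ unitDisk, f z =
      Complex.exp (∫ θ in circleSet,
        ((circlePt θ + z) / (circlePt θ - z)) * (φ θ : ℂ) / (2 * Real.pi))

/-- The Poisson kernel of the unit disk in polar form. -/
def polarPoisson (r t : ℝ) : ℝ := (1 - r ^ 2) / (1 - 2 * r * Real.cos t + r ^ 2)

/-- Minus the angular derivative of the Poisson kernel in polar form. -/
def polarPoissonDeriv (r t : ℝ) : ℝ :=
  (1 - r ^ 2) * (2 * r * Real.sin t) / (1 - 2 * r * Real.cos t + r ^ 2) ^ 2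

lemma polarPoisson_denom_pos {r : ℝ} (h0 : 0 ≤ r) (h1 : r < 1) (t : ℝ) :
    0 < 1 - 2 * r * Real.cos t + r ^ 2 := by
  nlinarith [Real.cos_le_one t, mul_nonneg h0 (sub_nonneg.2 (Real.cos_le_one t)),
    sq_pos_of_pos (sub_pos.2 h1)]

lemma polarPoisson_nonneg {r : ℝ} (h0 : 0 ≤ r) (h1 : r < 1) (t : ℝ) : 0 ≤ polarPoisson r t :=
  div_nonneg (by nlinarith) (polarPoisson_denom_pos h0 h1 t).le

lemma hasDerivAt_polarPoisson {r : ℝ} (h0 : 0 ≤ r) (h1 : r < 1) (t : ℝ) :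
    HasDerivAt (polarPoisson r) (-polarPoissonDeriv r t) t := by
  have hd := polarPoisson_denom_pos h0 h1 t
  have h : HasDerivAt (fun t => 1 - 2 * r * Real.cos t + r ^ 2) (2 * r * Real.sin t) t := by
    have := (((Real.hasDerivAt_cos t).const_mul (2 * r)).const_sub 1).add_const (r ^ 2)
    simpa using this
  have := (hasDerivAt_const t (1 - r ^ 2)).fun_div h hd.ne'
  unfold polarPoisson polarPoissonDeriv
  exact this.congr_deriv (by rw [← neg_div]; ring)

lemma continuous_polarPoisson {r : ℝ} (h0 : 0 ≤ r) (h1 : r < 1) :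
    Continuous (polarPoisson r) :=
  Continuous.div (by fun_prop) (by fun_prop) fun t => (polarPoisson_denom_pos h0 h1 t).ne'

lemma continuous_polarPoissonDeriv {r : ℝ} (h0 : 0 ≤ r) (h1 : r < 1) :
    Continuous (polarPoissonDeriv r) :=
  Continuous.div (by fun_prop) (by fun_prop)
    fun t => (pow_pos (polarPoisson_denom_pos h0 h1 t) 2).ne'

lemma circleMap_zero_one (θ : ℝ) : circleMap 0 1 θ = circlePt θ := by
  simp [circleMap, circlePt]

lemma norm_circlePt (θ : ℝ) : ‖circlePt θ‖ = 1 := by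
  simp [circlePt, Complex.norm_exp_ofReal_mul_I]

lemma continuous_circlePt : Continuous circlePt := by
  unfold circlePt; fun_prop

lemma circlePt_ne_zero (θ : ℝ) : circlePt θ ≠ 0 := Complex.exp_ne_zero _

lemma circlePt_add (s t : ℝ) : circlePt (s + t) = circlePt s * circlePt t := by
  simp [circlePt, add_mul, Complex.exp_add]

lemma norm_ofReal_mul_circlePt {r : ℝ} (h0 : 0 ≤ r) (θ : ℝ) : ‖(r : ℂ) * circlePt θ‖ = r := by
  rw [norm_mul, norm_circlePt, mul_one, Complex.norm_real, Real.norm_of_nonneg h0]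

lemma poissonKernel_circlePt {r : ℝ} (h0 : 0 ≤ r) (θ t : ℝ) :
    poissonKernel 0 (r * circlePt θ) (circlePt (θ + t)) = polarPoisson r t := by
  unfold poissonKernel polarPoisson
  have h2 : circlePt (θ + t) - r * circlePt θ = circlePt θ * (circlePt t - r) := by
    rw [circlePt_add]; ring
  have h3 : ‖circlePt t - r‖ ^ 2 = 1 - 2 * r * Real.cos t + r ^ 2 := by
    rw [circlePt, Complex.exp_mul_I, ← Complex.normSq_eq_norm_sq, Complex.normSq_apply]
    simp only [sub_re, add_re, ← ofReal_cos, ← ofReal_sin, ofReal_re, mul_re, I_re, mul_zero,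
      ofReal_im, I_im, sub_im, add_im, mul_im, mul_one]
    nlinarith [Real.sin_sq_add_cos_sq t]
  simp only [sub_zero]
  rw [h2, norm_ofReal_mul_circlePt h0, norm_mul, norm_circlePt, norm_circlePt, one_mul, h3, one_pow]

/-- Poisson integrals in polar coordinates centred at the evaluation angle. -/
lemma circleAverage_poissonKernel_eq {E : Type*} [NormedAddCommGroup E] [NormedSpace ℝ E]
    (g : ℂ → E) {r : ℝ} (h0 : 0 ≤ r) (θ : ℝ) :
    Real.circleAverage (poissonKernel 0 (r * circlePt θ) • g) 0 1 =
      (2 * Real.pi)⁻¹ • ∫ t in (-Real.pi)..Real.pi, polarPoisson r t • g (circlePt (θ + t)) := by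
  rw [Real.circleAverage_eq_integral_add (θ - Real.pi)]
  congr 1
  have := intervalIntegral.integral_comp_sub_right (a := 0) (b := 2 * Real.pi)
    (fun t => polarPoisson r t • g (circlePt (θ + t))) Real.pi
  rw [zero_sub, show 2 * Real.pi - Real.pi = Real.pi by ring] at this
  rw [← this]
  refine intervalIntegral.integral_congr fun t _ => ?_
  simp only [circleMap_zero_one, Pi.smul_apply']
  rw [show t + (θ - Real.pi) = θ + (t - Real.pi) by ring, poissonKernel_circlePt h0]

lemma mem_unitDisk_iff {z : ℂ} : z ∈ unitDisk ↔ z ∈ Metric.ball (0 : ℂ) 1 := by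
  simp [unitDisk]

lemma unitDisk_eq_ball : unitDisk = Metric.ball (0 : ℂ) 1 := by
  ext; exact mem_unitDisk_iff

lemma integral_polarPoisson {r : ℝ} (h0 : 0 ≤ r) (h1 : r < 1) :
    ∫ t in (-Real.pi)..Real.pi, polarPoisson r t = 2 * Real.pi := by
  have hw : (r : ℂ) * circlePt 0 ∈ Metric.ball (0 : ℂ) 1 := by
    rwa [mem_ball_zero_iff, norm_ofReal_mul_circlePt h0]
  have h := (diffContOnCl_const (c := (1 : ℂ)) (s := Metric.ball (0 : ℂ) 1)
    (𝕜 := ℂ)).circleAverage_poissonKernel_smul hw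
  have h' := (circleAverage_poissonKernel_eq (fun _ => (1 : ℂ)) h0 0)
  rw [h] at h'
  have h2 : ∫ t in (-Real.pi)..Real.pi, polarPoisson r t • (1 : ℂ) =
      ((∫ t in (-Real.pi)..Real.pi, polarPoisson r t : ℝ) : ℂ) := by
    rw [← intervalIntegral.integral_ofReal]; simp
  rw [h2] at h'
  have h3 : (1 : ℝ) = (2 * Real.pi)⁻¹ * ∫ t in (-Real.pi)..Real.pi, polarPoisson r t := by
    have := h'
    rw [Complex.real_smul] at this
    exact_mod_cast this
  have hpi := Real.pi_pos
  field_simp at h3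
  linarith

/-- The peak functions `t ↦ -t P_r'(t) / 2π`. -/
def poissonPeak (r t : ℝ) : ℝ := (2 * Real.pi)⁻¹ * (t * polarPoissonDeriv r t)

lemma polarPoisson_pi {r : ℝ} (h0 : 0 ≤ r) : polarPoisson r Real.pi = (1 - r) / (1 + r) := by
  unfold polarPoisson
  rw [Real.cos_pi, div_eq_div_iff (by nlinarith) (by linarith)]
  ring

lemma polarPoisson_neg (r t : ℝ) : polarPoisson r (-t) = polarPoisson r t := by
  simp [polarPoisson]

lemma polarPoissonDeriv_neg (r t : ℝ) : polarPoissonDeriv r (-t) = -polarPoissonDeriv r t := by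
  simp [polarPoissonDeriv, neg_div]

lemma integral_poissonPeak {r : ℝ} (h0 : 0 ≤ r) (h1 : r < 1) :
    ∫ t in (-Real.pi)..Real.pi, poissonPeak r t = 1 - (1 - r) / (1 + r) := by
  have hi := intervalIntegral.integral_mul_deriv_eq_deriv_mul (a := -Real.pi) (b := Real.pi)
    (u := fun t => t) (u' := fun _ => 1) (v := polarPoisson r)
    (v' := fun t => -polarPoissonDeriv r t)
    (fun t _ => hasDerivAt_id t) (fun t _ => hasDerivAt_polarPoisson h0 h1 t)
    (by simp) ((continuous_polarPoissonDeriv h0 h1).neg.intervalIntegrable _ _)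
  simp only [one_mul, integral_polarPoisson h0 h1, polarPoisson_neg, polarPoisson_pi h0,
    mul_neg, intervalIntegral.integral_neg] at hi
  unfold poissonPeak
  rw [intervalIntegral.integral_const_mul]
  have : ∫ t in (-Real.pi)..Real.pi, t * polarPoissonDeriv r t =
      2 * Real.pi * (1 - (1 - r) / (1 + r)) := by linarith
  rw [this]
  have hpi := Real.pi_pos
  field_simp

lemma poissonPeak_nonneg {r : ℝ} (h0 : 0 ≤ r) (h1 : r < 1) {t : ℝ}
    (ht : t ∈ Icc (-Real.pi) Real.pi) : 0 ≤ poissonPeak r t := by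
  have hs : 0 ≤ t * Real.sin t := by
    rcases le_total 0 t with h | h
    · exact mul_nonneg h (Real.sin_nonneg_of_nonneg_of_le_pi h ht.2)
    · exact mul_nonneg_of_nonpos_of_nonpos h (Real.sin_nonpos_of_nonpos_of_neg_pi_le h ht.1)
  have : t * polarPoissonDeriv r t = (1 - r ^ 2) * (2 * r) * (t * Real.sin t) /
      (1 - 2 * r * Real.cos t + r ^ 2) ^ 2 := by
    unfold polarPoissonDeriv; ring
  unfold poissonPeak
  rw [this]
  have h2 : 0 ≤ 1 - r ^ 2 := by nlinarith
  have := Real.pi_pos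
  positivity

lemma poissonPeak_le {r δ t : ℝ} (h0 : 1 / 2 ≤ r) (h1 : r < 1) (hδ : 0 < δ)
    (ht : t ∈ Icc (-Real.pi) Real.pi) (hδt : δ ≤ |t|) :
    poissonPeak r t ≤ (1 - r ^ 2) * ((1 - Real.cos δ) ^ 2)⁻¹ := by
  have htpi : |t| ≤ Real.pi := abs_le.2 ht
  have hcos : Real.cos t ≤ Real.cos δ := by
    rw [← Real.cos_abs t]
    exact Real.cos_le_cos_of_nonneg_of_le_pi hδ.le htpi hδt
  have hcos1 : Real.cos δ < 1 := by
    have := Real.cos_lt_cos_of_nonneg_of_le_pi le_rfl (hδt.trans htpi) hδ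
    simpa using this
  have hden : 1 - Real.cos δ ≤ 1 - 2 * r * Real.cos t + r ^ 2 := by
    nlinarith [sq_nonneg (1 - r), Real.cos_le_one t]
  have h2 : 0 ≤ 1 - r ^ 2 := by nlinarith
  have hpi := Real.pi_pos
  have hnum : t * Real.sin t ≤ Real.pi := by
    calc t * Real.sin t ≤ |t * Real.sin t| := le_abs_self _
      _ = |t| * |Real.sin t| := abs_mul _ _
      _ ≤ Real.pi * 1 := by gcongr; exact Real.abs_sin_le_one t
      _ = Real.pi := mul_one _
  have hc : 0 < 1 - Real.cos δ := by linarith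
  have e : poissonPeak r t = (1 - r ^ 2) * (r * (t * Real.sin t) / Real.pi) *
      ((1 - 2 * r * Real.cos t + r ^ 2) ^ 2)⁻¹ := by
    unfold poissonPeak polarPoissonDeriv; field_simp
  have hle : r * (t * Real.sin t) / Real.pi ≤ 1 := by
    rw [div_le_one hpi]
    nlinarith
  rw [e]
  calc _ ≤ (1 - r ^ 2) * 1 * ((1 - 2 * r * Real.cos t + r ^ 2) ^ 2)⁻¹ := by gcongr
    _ ≤ _ := by rw [mul_one]; gcongr

lemma eventually_nhdsLT_one {a : ℝ} (ha : a < 1) : ∀ᶠ r in nhdsWithin (1 : ℝ) (Iio 1), a < r ∧ r < 1 :=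
  Ioo_mem_nhdsLT ha

lemma tendsto_one_sub_sq_mul (C : ℝ) :
    Tendsto (fun r : ℝ => (1 - r ^ 2) * C) (nhdsWithin 1 (Iio 1)) (nhds 0) := by
  have : ContinuousAt (fun r : ℝ => (1 - r ^ 2) * C) 1 := by fun_prop
  have h := this.tendsto
  norm_num at h
  exact h.mono_left nhdsWithin_le_nhds

lemma tendsto_one_sub_div_one_add :
    Tendsto (fun r : ℝ => (1 - r) / (1 + r)) (nhdsWithin 1 (Iio 1)) (nhds 0) := by
  have : ContinuousAt (fun r : ℝ => (1 - r) / (1 + r)) 1 :=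
    ContinuousAt.div (by fun_prop) (by fun_prop) (by norm_num)
  have h := this.tendsto
  norm_num at h
  exact h.mono_left nhdsWithin_le_nhds

/-- The angular derivative of the Poisson integral of `G` tends radially to the derivative of `G`
wherever the latter exists. -/
theorem tendsto_integral_polarPoissonDeriv {E : Type*} [NormedAddCommGroup E] [NormedSpace ℝ E]
    [CompleteSpace E] {G : ℝ → E} (hG : Continuous G) {θ : ℝ} {c : E} (hc : HasDerivAt G c θ) :
    Tendsto (fun r : ℝ => (2 * Real.pi)⁻¹ •
      ∫ t in (-Real.pi)..Real.pi, polarPoissonDeriv r t • G (θ + t))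
      (nhdsWithin 1 (Iio 1)) (nhds c) := by
  have hpi := Real.pi_pos
  set s : Set ℝ := Icc (-Real.pi) Real.pi \ {0} with hs
  have hsm : MeasurableSet s := measurableSet_Icc.diff (measurableSet_singleton 0)
  set g : ℝ → E := fun t => t⁻¹ • (G (θ + t) - G θ) with hg
  have hgt : Tendsto g (nhdsWithin 0 {0}ᶜ) (nhds c) := hasDerivAt_iff_tendsto_slope_zero.1 hc
  have hgm : ContinuousOn g s := by
    intro t ht
    have : t ≠ 0 := ht.2
    exact ContinuousAt.continuousWithinAt (by fun_prop (disch := assumption))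
  have hsv : s =ᵐ[volume] Icc (-Real.pi) Real.pi := sdiff_null_ae_eq_self (by simp)
  have hsfin : volume s ≠ ⊤ := by
    rw [measure_congr hsv]; simp
  have hgi : IntegrableOn g s := by
    obtain ⟨M, hM⟩ := (isCompact_Icc (a := -Real.pi) (b := Real.pi)).exists_bound_of_continuousOn
      (f := fun t => G (θ + t) - G θ) (by fun_prop)
    have h1 := hgt.norm.eventually (gt_mem_nhds (lt_add_one ‖c‖))
    rw [eventually_nhdsWithin_iff, Metric.eventually_nhds_iff] at h1
    obtain ⟨δ, hδ, h1⟩ := h1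
    refine IntegrableOn.of_bound hsfin.lt_top (hgm.aestronglyMeasurable hsm)
      (max (‖c‖ + 1) (δ⁻¹ * M)) ?_
    refine (ae_restrict_iff' hsm).2 (Eventually.of_forall fun t ht => ?_)
    by_cases htd : |t| < δ
    · exact le_max_of_le_left (h1 (by simpa [Real.dist_eq] using htd) ht.2).le
    · refine le_max_of_le_right ?_
      rw [hg, norm_smul, norm_inv, Real.norm_eq_abs]
      push Not at htd
      have := hM t ht.1
      gcongr
  have hIcc (F : ℝ → E) : ∫ t in s, F t = ∫ t in (-Real.pi)..Real.pi, F t := by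
    rw [intervalIntegral.integral_of_le (by linarith), ← integral_Icc_eq_integral_Ioc,
      setIntegral_congr_set hsv]
  have hr : ∀ᶠ r in nhdsWithin (1 : ℝ) (Iio 1), 1 / 2 < r ∧ r < 1 :=
    eventually_nhdsLT_one (by norm_num)
  have key : Tendsto (fun r => ∫ t in s, poissonPeak r t • g t) (nhdsWithin 1 (Iio 1))
      (nhds c) := by
    refine tendsto_setIntegral_peak_smul_of_integrableOn_of_tendsto (x₀ := 0) (t := s)
      hsm hsm subset_rfl self_mem_nhdsWithin hsfin ?_ ?_ ?_ ?_ hgi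
      (hgt.mono_left (nhdsWithin_mono _ fun t ht => ht.2))
    · filter_upwards [hr] with r hr t ht
      exact poissonPeak_nonneg (by linarith) hr.2 ht.1
    · intro u hu h0u
      obtain ⟨δ, hδ, hδu⟩ := Metric.isOpen_iff.1 hu 0 h0u
      rw [Metric.tendstoUniformlyOn_iff]
      intro ε hε
      filter_upwards [hr, (tendsto_one_sub_sq_mul ((1 - Real.cos δ) ^ 2)⁻¹).eventually
        (gt_mem_nhds hε)] with r hr hrε t ht
      have htδ : δ ≤ |t| := by
        by_contra! h
        exact ht.2 (hδu (by simpa using h))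
      rw [Pi.zero_apply, dist_zero_left, Real.norm_of_nonneg
        (poissonPeak_nonneg (by linarith) hr.2 ht.1.1)]
      exact (poissonPeak_le hr.1.le hr.2 hδ ht.1.1 htδ).trans_lt hrε
    · have h1 : Tendsto (fun r : ℝ => 1 - (1 - r) / (1 + r)) (nhdsWithin 1 (Iio 1)) (nhds 1) := by
        simpa using tendsto_one_sub_div_one_add.const_sub 1
      refine h1.congr' ?_
      filter_upwards [hr] with r hr
      rw [← integral_poissonPeak (by linarith) hr.2, intervalIntegral.integral_of_le (by linarith),
        ← integral_Icc_eq_integral_Ioc, setIntegral_congr_set hsv]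
    · filter_upwards [hr] with r hr
      have := continuous_polarPoissonDeriv (by linarith [hr.1] : 0 ≤ r) hr.2
      unfold poissonPeak
      exact Continuous.aestronglyMeasurable (by fun_prop)
  refine key.congr' ?_
  filter_upwards [hr] with r hr
  have hcont := continuous_polarPoissonDeriv (by linarith [hr.1] : 0 ≤ r) hr.2
  have hodd : ∫ t in (-Real.pi)..Real.pi, polarPoissonDeriv r t = 0 := by
    have := intervalIntegral.integral_comp_neg (a := -Real.pi) (b := Real.pi) (polarPoissonDeriv r)
    simp only [polarPoissonDeriv_neg, intervalIntegral.integral_neg, neg_neg] at this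
    linarith
  have e : ∫ t in s, poissonPeak r t • g t =
      ∫ t in s, (2 * Real.pi)⁻¹ • (polarPoissonDeriv r t • G (θ + t) -
        polarPoissonDeriv r t • G θ) := by
    refine setIntegral_congr_fun hsm fun t ht => ?_
    have ht0 : t ≠ 0 := ht.2
    simp only [poissonPeak, hg]
    rw [← smul_sub, smul_smul, smul_smul]
    congr 1
    field_simp
  rw [e, hIcc, intervalIntegral.integral_smul, intervalIntegral.integral_sub,
    intervalIntegral.integral_smul_const, hodd, zero_smul, sub_zero]
  · exact Continuous.intervalIntegrable (by fun_prop) _ _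
  · exact Continuous.intervalIntegrable (by fun_prop) _ _

lemma hasDerivAt_circlePt (θ : ℝ) : HasDerivAt circlePt (I * circlePt θ) θ := by
  have := (((hasDerivAt_id θ).ofReal_comp).mul_const I).cexp
  refine (show HasDerivAt (fun t : ℝ => Complex.exp (t * I)) _ θ from this).congr_deriv ?_
  simp [circlePt, mul_comm]

lemma ofReal_mul_circlePt_mem {r : ℝ} (h0 : 0 ≤ r) (h1 : r < 1) (θ : ℝ) :
    (r : ℂ) * circlePt θ ∈ unitDisk := by
  rwa [unitDisk, mem_ofPred_eq, norm_ofReal_mul_circlePt h0]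

lemma isOpen_unitDisk : IsOpen unitDisk := unitDisk_eq_ball ▸ Metric.isOpen_ball

/-- Dilations of functions analytic in the disk are analytic up to the boundary. -/
lemma diffContOnCl_dilate {f : ℂ → ℂ} (hf : DifferentiableOn ℂ f unitDisk) {ρ : ℝ}
    (h0 : 0 ≤ ρ) (h1 : ρ < 1) :
    DiffContOnCl ℂ (fun z => f (ρ * z)) (Metric.ball 0 1) := by
  refine DifferentiableOn.diffContOnCl (hf.comp (by fun_prop) fun z hz => ?_)
  rw [closure_ball _ one_ne_zero, mem_closedBall_zero_iff] at hz
  rw [unitDisk, mem_ofPred_eq, norm_mul, Complex.norm_real, Real.norm_of_nonneg h0]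
  nlinarith

lemma eq_integral_polarPoissonDeriv {f F H : ℂ → ℂ} (hf : DifferentiableOn ℂ f unitDisk)
    (hF : ∀ z ∈ unitDisk, HasDerivAt F (f z) z) (hH : Continuous H) (hFH : EqOn F H unitDisk)
    {r : ℝ} (h0 : 0 ≤ r) (h1 : r < 1) (θ : ℝ) :
    I * (r * circlePt θ) * f (r * circlePt θ) = (2 * Real.pi)⁻¹ •
      ∫ t in (-Real.pi)..Real.pi, polarPoissonDeriv r t • H (circlePt (θ + t)) := by
  set z : ℂ := r * circlePt θ with hz
  have hzm : z ∈ unitDisk := ofReal_mul_circlePt_mem h0 h1 θ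
  have hc := continuous_polarPoissonDeriv h0 h1
  have hcp := continuous_circlePt
  have hdil : ∀ ρ : ℝ, 0 < ρ → ρ < 1 → I * (ρ * z) * f (ρ * z) = (2 * Real.pi)⁻¹ •
      ∫ t in (-Real.pi)..Real.pi, polarPoissonDeriv r t • H (ρ * circlePt (θ + t)) := by
    intro ρ hρ0 hρ1
    have hu : DifferentiableOn ℂ (fun w => I * w * f w) unitDisk := by fun_prop
    have hp := (diffContOnCl_dilate hu hρ0.le hρ1).circleAverage_poissonKernel_smul
      (mem_unitDisk_iff.1 hzm)
    rw [circleAverage_poissonKernel_eq _ h0] at hp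
    rw [← hp]
    congr 1
    have hmem (t : ℝ) : (ρ : ℂ) * circlePt (θ + t) ∈ unitDisk :=
      ofReal_mul_circlePt_mem hρ0.le hρ1 _
    have hv (t : ℝ) : HasDerivAt (fun t : ℝ => H (ρ * circlePt (θ + t)))
        (I * (ρ * circlePt (θ + t)) * f (ρ * circlePt (θ + t))) t := by
      have h2 : HasDerivAt (fun t : ℝ => (ρ : ℂ) * circlePt (θ + t))
          (ρ * (I * circlePt (θ + t))) t :=
        ((hasDerivAt_circlePt (θ + t)).comp_const_add θ t).const_mul _
      have h3 := (hF _ (hmem t)).comp t h2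
      refine (h3.congr_deriv (by ring)).congr_of_eventuallyEq (Eventually.of_forall fun x => ?_)
      exact (hFH (hmem x)).symm
    have hcf : Continuous fun t : ℝ => f (ρ * circlePt (θ + t)) :=
      hf.continuousOn.comp_continuous (by fun_prop) hmem
    have hi := intervalIntegral.integral_smul_deriv_eq_deriv_smul (a := -Real.pi) (b := Real.pi)
      (fun t _ => hasDerivAt_polarPoisson h0 h1 t) (fun t _ => hv t)
      (hc.neg.intervalIntegrable _ _)
      (Continuous.intervalIntegrable (Continuous.mul (by fun_prop) hcf) _ _)
    rw [hi]
    have hper : circlePt (θ + -Real.pi) = circlePt (θ + Real.pi) := by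
      rw [circlePt_add, circlePt_add]
      simp [circlePt, Complex.exp_neg]
    simp [hper, polarPoisson_neg]
  have hlim1 : Tendsto (fun ρ : ℝ => I * (ρ * z) * f (ρ * z)) (nhdsWithin 1 (Iio 1))
      (nhds (I * z * f z)) := by
    have hfz : ContinuousAt f (((1 : ℝ) : ℂ) * z) := by
      simpa using (hf.differentiableAt (isOpen_unitDisk.mem_nhds hzm)).continuousAt
    have : ContinuousAt (fun ρ : ℝ => I * (ρ * z) * f (ρ * z)) 1 := by
      refine ContinuousAt.mul (by fun_prop) ?_
      exact ContinuousAt.comp (f := fun ρ : ℝ => (ρ : ℂ) * z) hfz (by fun_prop)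
    have h := this.tendsto
    simp only [Complex.ofReal_one, one_mul] at h
    exact h.mono_left nhdsWithin_le_nhds
  have hlim2 : Tendsto (fun ρ : ℝ => (2 * Real.pi)⁻¹ • ∫ t in (-Real.pi)..Real.pi,
      polarPoissonDeriv r t • H (ρ * circlePt (θ + t))) (nhdsWithin 1 (Iio 1))
      (nhds ((2 * Real.pi)⁻¹ • ∫ t in (-Real.pi)..Real.pi,
        polarPoissonDeriv r t • H (circlePt (θ + t)))) := by
    have hcont : Continuous fun ρ : ℝ => ∫ t in (-Real.pi)..Real.pi,
        polarPoissonDeriv r t • H (ρ * circlePt (θ + t)) :=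
      intervalIntegral.continuous_parametric_intervalIntegral_of_continuous' (by fun_prop) _ _
    have h := (hcont.tendsto 1).const_smul (2 * Real.pi)⁻¹
    simp only [Complex.ofReal_one, one_mul] at h
    exact h.mono_left nhdsWithin_le_nhds
  refine tendsto_nhds_unique (hlim1.congr' ?_) hlim2
  filter_upwards [eventually_nhdsLT_one zero_lt_one] with ρ hρ
  exact hdil ρ hρ.1 hρ.2

/-- **Fatou's theorem**: bounded analytic functions on the disk have radial limits a.e. -/
theorem ae_exists_radLim {f : ℂ → ℂ} {C : ℝ} (hf : DifferentiableOn ℂ f unitDisk)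
    (hC : ∀ z ∈ unitDisk, ‖f z‖ ≤ C) : ∀ᵐ θ : ℝ, ∃ w, RadLim f θ w := by
  obtain ⟨F, hF⟩ : Complex.IsExactOn f unitDisk :=
    unitDisk_eq_ball ▸ DifferentiableOn.isExactOn_ball (unitDisk_eq_ball ▸ hf)
  have hlip : LipschitzOnWith C.toNNReal F unitDisk := by
    refine Convex.lipschitzOnWith_of_nnnorm_hasDerivWithin_le
      (unitDisk_eq_ball ▸ convex_ball (0 : ℂ) 1) (fun z hz => (hF z hz).hasDerivWithinAt) ?_
    intro z hz
    exact NNReal.coe_le_coe.1 ((hC z hz).trans (Real.le_coe_toNNReal C))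
  obtain ⟨H, hH, hFH⟩ := hlip.extend_finite_dimension
  have hcp : LipschitzWith (Real.nnabs 1) circlePt := by
    have := lipschitzWith_circleMap 0 1
    rwa [show circleMap 0 1 = circlePt from funext circleMap_zero_one] at this
  have hG := hH.comp hcp
  filter_upwards [hG.ae_differentiableAt_real] with θ hθ
  have hlim := tendsto_integral_polarPoissonDeriv hG.continuous hθ.hasDerivAt
  set c := deriv (H ∘ circlePt) θ
  refine ⟨c / (I * circlePt θ), ?_⟩
  have hden : Tendsto (fun r : ℝ => I * (r * circlePt θ)) (nhdsWithin 1 (Iio 1))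
      (nhds (I * circlePt θ)) := by
    have : Continuous fun r : ℝ => I * (r * circlePt θ) := by fun_prop
    have h := this.tendsto 1
    simp only [Complex.ofReal_one, one_mul] at h
    exact h.mono_left nhdsWithin_le_nhds
  have h := hlim.div hden (mul_ne_zero I_ne_zero (circlePt_ne_zero θ))
  refine h.congr' ?_
  filter_upwards [eventually_nhdsLT_one zero_lt_one] with r hr
  have hr0 : (r : ℂ) ≠ 0 := by exact_mod_cast hr.1.ne'
  have := eq_integral_polarPoissonDeriv hf hF hH.continuous hFH hr.1.le hr.2 θ
  simp only [Pi.div_apply, Function.comp_apply]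
  rw [← this, mul_div_cancel_left₀]
  exact mul_ne_zero I_ne_zero (mul_ne_zero hr0 (circlePt_ne_zero θ))

lemma contDiff_polarPoisson {r : ℝ} (h0 : 0 ≤ r) (h1 : r < 1) : ContDiff ℝ 1 (polarPoisson r) :=
  ContDiff.div (by fun_prop) (by fun_prop) fun t => (polarPoisson_denom_pos h0 h1 t).ne'

lemma CircleIntegrable.intervalIntegrable_circlePt {E : Type*} [NormedAddCommGroup E]
    {g : ℂ → E} (hg : CircleIntegrable g 0 1) (a b : ℝ) :
    IntervalIntegrable (fun t => g (circlePt t)) volume a b := by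
  have hper : Function.Periodic (fun t => g (circlePt t)) (2 * Real.pi) := by
    intro t
    simp only [← circleMap_zero_one, periodic_circleMap 0 1 t]
  refine hper.intervalIntegrable₀ Real.two_pi_pos.ne' ?_ a b
  simpa only [CircleIntegrable, circleMap_zero_one] using hg

lemma locallyIntegrable_of_intervalIntegrable {E : Type*} [NormedAddCommGroup E] {u : ℝ → E}
    (hu : ∀ a b, IntervalIntegrable u volume a b) : LocallyIntegrable u := fun x =>
  ⟨Ioo (x - 1) (x + 1), Ioo_mem_nhds (by linarith) (by linarith),
    (hu (x - 1) (x + 1)).1.mono_set Ioo_subset_Ioc_self⟩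

/-- Poisson integrals of integrable functions converge radially almost everywhere. -/
theorem ae_tendsto_circleAverage_poissonKernel {ψ : ℂ → ℝ} (hψ : CircleIntegrable ψ 0 1) :
    ∀ᵐ θ : ℝ, Tendsto
      (fun r : ℝ => Real.circleAverage (poissonKernel 0 (r * circlePt θ) • ψ) 0 1)
      (nhdsWithin 1 (Iio 1)) (nhds (ψ (circlePt θ))) := by
  have hu := hψ.intervalIntegrable_circlePt
  set u : ℝ → ℝ := fun t => ψ (circlePt t) with hu_def
  filter_upwards [_root_.LocallyIntegrable.ae_hasDerivAt_integral
    (locallyIntegrable_of_intervalIntegrable hu)] with θ hθ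
  have hG : Continuous fun x => ∫ t in (θ - Real.pi)..x, u t :=
    intervalIntegral.continuous_primitive hu _
  have hlim := tendsto_integral_polarPoissonDeriv hG (hθ (θ - Real.pi))
  have hbd : Tendsto (fun r : ℝ => (1 - r) / (1 + r) *
      ((2 * Real.pi)⁻¹ * ∫ t in (θ - Real.pi)..(θ + Real.pi), u t))
      (nhdsWithin 1 (Iio 1)) (nhds 0) := by
    simpa using tendsto_one_sub_div_one_add.mul_const
      ((2 * Real.pi)⁻¹ * ∫ t in (θ - Real.pi)..(θ + Real.pi), u t)
  have hsum := hbd.add hlim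
  rw [zero_add] at hsum
  refine hsum.congr' ?_
  filter_upwards [eventually_nhdsLT_one zero_lt_one] with r ⟨hr0, hr1⟩
  rw [circleAverage_poissonKernel_eq _ hr0.le]
  have hshift (a b : ℝ) : IntervalIntegrable (fun t => u (θ + t)) volume a b := by
    simpa using (hu (a + θ) (b + θ)).comp_add_left θ
  have hprim (x : ℝ) : ∫ t in (-Real.pi)..x, u (θ + t) = ∫ t in (θ - Real.pi)..(θ + x), u t := by
    rw [intervalIntegral.integral_comp_add_left (fun t => u t), sub_eq_add_neg]
  have hac := (hshift (-Real.pi) Real.pi).absolutelyContinuousOnInterval_intervalIntegral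
    (left_mem_uIcc)
  have hpac : AbsolutelyContinuousOnInterval (polarPoisson r) (-Real.pi) Real.pi :=
    (contDiff_polarPoisson hr0.le hr1).contDiffOn.absolutelyContinuousOnInterval
  have hparts := hpac.integral_mul_deriv_eq_deriv_mul hac
  have hderiv : ∫ t in (-Real.pi)..Real.pi,
      polarPoisson r t * deriv (fun x => ∫ v in (-Real.pi)..x, u (θ + v)) t =
      ∫ t in (-Real.pi)..Real.pi, polarPoisson r t * u (θ + t) := by
    refine intervalIntegral.integral_congr_ae ?_
    filter_upwards [_root_.LocallyIntegrable.ae_hasDerivAt_integral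
      (locallyIntegrable_of_intervalIntegrable hshift)]
      with t ht _
    rw [(ht _).deriv]
  have hderiv' (t : ℝ) : deriv (polarPoisson r) t = -polarPoissonDeriv r t :=
    (hasDerivAt_polarPoisson hr0.le hr1 t).deriv
  rw [hderiv] at hparts
  simp only [hderiv', hprim, neg_mul, intervalIntegral.integral_neg, polarPoisson_pi hr0.le,
    polarPoisson_neg] at hparts
  simp only [smul_eq_mul]
  rw [hparts, ← sub_eq_add_neg θ Real.pi, intervalIntegral.integral_same]
  ring

lemma circleIntegrable_iff_integrableOn_circleSet {E : Type*} [NormedAddCommGroup E] {g : ℂ → E} :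
    CircleIntegrable g 0 1 ↔ IntegrableOn (fun t => g (circlePt t)) circleSet := by
  simp only [CircleIntegrable, circleMap_zero_one, circleSet]
  exact intervalIntegrable_iff_integrableOn_Ioc_of_le Real.two_pi_pos.le

lemma circleAverage_eq_setIntegral {E : Type*} [NormedAddCommGroup E] [NormedSpace ℝ E]
    (g : ℂ → E) :
    Real.circleAverage g 0 1 = (2 * Real.pi)⁻¹ • ∫ t in circleSet, g (circlePt t) := by
  rw [Real.circleAverage_def, intervalIntegral.integral_of_le Real.two_pi_pos.le]
  simp only [circleMap_zero_one, circleSet]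

lemma poissonKernel_eq_polarPoisson {z : ℂ} (t : ℝ) :
    poissonKernel 0 z (circlePt t) = polarPoisson ‖z‖ (t - z.arg) := by
  have h := poissonKernel_circlePt (norm_nonneg z) z.arg (t - z.arg)
  rwa [add_sub_cancel, circlePt, Complex.norm_mul_exp_arg_mul_I] at h

lemma poissonKernel_circlePt_nonneg {z : ℂ} (hz : z ∈ unitDisk) (t : ℝ) :
    0 ≤ poissonKernel 0 z (circlePt t) := by
  rw [poissonKernel_eq_polarPoisson]
  exact polarPoisson_nonneg (norm_nonneg z) hz _

lemma continuous_poissonKernel_circlePt {z : ℂ} (hz : z ∈ unitDisk) :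
    Continuous fun t => poissonKernel 0 z (circlePt t) := by
  simp only [poissonKernel_eq_polarPoisson]
  exact (continuous_polarPoisson (norm_nonneg z) hz).comp (by fun_prop)

/-- The Poisson integral over the unit circle. -/
def poissonIntegral (ψ : ℂ → ℝ) (z : ℂ) : ℝ := Real.circleAverage (poissonKernel 0 z • ψ) 0 1

lemma poissonIntegral_eq (ψ : ℂ → ℝ) (z : ℂ) :
    poissonIntegral ψ z = (2 * Real.pi)⁻¹ *
      ∫ t in circleSet, poissonKernel 0 z (circlePt t) * ψ (circlePt t) :=
  circleAverage_eq_setIntegral _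

lemma integrableOn_poissonKernel_mul {ψ : ℂ → ℝ} (hψ : CircleIntegrable ψ 0 1) {z : ℂ}
    (hz : z ∈ unitDisk) :
    IntegrableOn (fun t => poissonKernel 0 z (circlePt t) * ψ (circlePt t)) circleSet := by
  have h := hψ.intervalIntegrable_circlePt 0 (2 * Real.pi)
  have h2 := h.continuousOn_mul (continuous_poissonKernel_circlePt hz).continuousOn
  exact (intervalIntegrable_iff_integrableOn_Ioc_of_le Real.two_pi_pos.le).1 h2

lemma poissonIntegral_const (c : ℝ) {z : ℂ} (hz : z ∈ unitDisk) :
    poissonIntegral (fun _ => c) z = c := by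
  have h := (diffContOnCl_const (c := (c : ℂ)) (s := Metric.ball (0 : ℂ) 1)
    (𝕜 := ℂ)).circleAverage_poissonKernel_smul (mem_unitDisk_iff.1 hz)
  rw [circleAverage_eq_setIntegral] at h
  rw [poissonIntegral_eq]
  simp only [Pi.smul_apply', Complex.real_smul, ← Complex.ofReal_mul] at h
  rw [integral_complex_ofReal, ← Complex.ofReal_mul] at h
  exact_mod_cast h

lemma poissonIntegral_mono {φ ψ : ℂ → ℝ} (hφ : CircleIntegrable φ 0 1)
    (hψ : CircleIntegrable ψ 0 1)
    (h : ∀ᵐ t ∂(volume.restrict circleSet), φ (circlePt t) ≤ ψ (circlePt t)) {z : ℂ}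
    (hz : z ∈ unitDisk) : poissonIntegral φ z ≤ poissonIntegral ψ z := by
  rw [poissonIntegral_eq, poissonIntegral_eq]
  refine mul_le_mul_of_nonneg_left ?_ (by positivity)
  refine integral_mono_ae (integrableOn_poissonKernel_mul hφ hz)
    (integrableOn_poissonKernel_mul hψ hz) ?_
  filter_upwards [h] with t ht
  exact mul_le_mul_of_nonneg_left ht (poissonKernel_circlePt_nonneg hz t)

lemma poissonIntegral_add {φ ψ : ℂ → ℝ} (hφ : CircleIntegrable φ 0 1)
    (hψ : CircleIntegrable ψ 0 1) {z : ℂ} (hz : z ∈ unitDisk) :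
    poissonIntegral (φ + ψ) z = poissonIntegral φ z + poissonIntegral ψ z := by
  simp only [poissonIntegral_eq, Pi.add_apply, mul_add]
  rw [integral_add (integrableOn_poissonKernel_mul hφ hz) (integrableOn_poissonKernel_mul hψ hz),
    mul_add]

/-- Dominated convergence for Poisson integrals. -/
lemma tendsto_poissonIntegral {ι : Type*} {l : Filter ι} [l.IsCountablyGenerated]
    {F : ι → ℂ → ℝ} {f B : ℂ → ℝ} (hB : CircleIntegrable B 0 1)
    (hF : ∀ᶠ n in l, CircleIntegrable (F n) 0 1)
    (hFB : ∀ᶠ n in l, ∀ t, |F n (circlePt t)| ≤ B (circlePt t))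
    (hlim : ∀ᵐ t ∂(volume.restrict circleSet),
      Tendsto (fun n => F n (circlePt t)) l (nhds (f (circlePt t))))
    {z : ℂ} (hz : z ∈ unitDisk) :
    Tendsto (fun n => poissonIntegral (F n) z) l (nhds (poissonIntegral f z)) := by
  simp only [poissonIntegral_eq]
  refine Tendsto.const_mul _ (tendsto_integral_filter_of_dominated_convergence _ ?_ ?_
    (integrableOn_poissonKernel_mul hB hz) ?_)
  · filter_upwards [hF] with n hn
    exact (integrableOn_poissonKernel_mul hn hz).aestronglyMeasurable
  · filter_upwards [hFB] with n hn
    refine Eventually.of_forall fun t => ?_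
    have hk := poissonKernel_circlePt_nonneg hz t
    rw [norm_mul, Real.norm_of_nonneg hk]
    exact mul_le_mul_of_nonneg_left (hn t) hk
  · filter_upwards [hlim] with t ht
    exact ht.const_mul _

lemma norm_le_poissonIntegral {f : ℂ → ℂ} (hf : DiffContOnCl ℂ f (Metric.ball 0 1)) {z : ℂ}
    (hz : z ∈ unitDisk) : ‖f z‖ ≤ poissonIntegral (fun ζ => ‖f ζ‖) z := by
  rw [← hf.circleAverage_poissonKernel_smul (mem_unitDisk_iff.1 hz), circleAverage_eq_setIntegral,
    poissonIntegral_eq, norm_smul, Real.norm_of_nonneg (by positivity)]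
  refine mul_le_mul_of_nonneg_left ((norm_integral_le_integral_norm _).trans_eq ?_)
    (by positivity)
  refine integral_congr_ae (Eventually.of_forall fun t => ?_)
  simp only [Pi.smul_apply', norm_smul]
  rw [Real.norm_of_nonneg (poissonKernel_circlePt_nonneg hz t)]

/-- A bounded analytic function whose boundary moduli are at most one is contractive. -/
theorem norm_le_one_of_radial {f : ℂ → ℂ} {C : ℝ} (hf : DifferentiableOn ℂ f unitDisk)
    (hC : ∀ z ∈ unitDisk, ‖f z‖ ≤ C)
    (hbd : ∀ᵐ t ∂(volume.restrict circleSet), ∃ c ≤ (1 : ℝ),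
      Tendsto (fun r : ℝ => ‖f (r * circlePt t)‖) (nhdsWithin 1 (Iio 1)) (nhds c))
    {z : ℂ} (hz : z ∈ unitDisk) : ‖f z‖ ≤ 1 := by
  have hcont {ρ : ℝ} (h0 : 0 < ρ) (h1 : ρ < 1) :
      ContinuousOn (fun ζ : ℂ => f (ρ * ζ)) (Metric.sphere 0 1) := by
    refine (diffContOnCl_dilate hf h0.le h1).continuousOn.mono ?_
    rw [closure_ball _ one_ne_zero]
    exact Metric.sphere_subset_closedBall
  have hlim : Tendsto (fun ρ : ℝ => poissonIntegral (fun ζ => max ‖f (ρ * ζ)‖ 1) z)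
      (nhdsWithin 1 (Iio 1)) (nhds (poissonIntegral (fun _ => 1) z)) := by
    refine tendsto_poissonIntegral (B := fun _ => max C 1) (circleIntegrable_const _ _ _)
      ?_ ?_ ?_ hz
    · filter_upwards [eventually_nhdsLT_one zero_lt_one] with ρ hρ
      exact ContinuousOn.circleIntegrable zero_le_one
        ((hcont hρ.1 hρ.2).norm.sup continuousOn_const)
    · filter_upwards [eventually_nhdsLT_one zero_lt_one] with ρ hρ t
      rw [abs_of_nonneg (by positivity)]
      exact max_le_max_right _ (hC _ (ofReal_mul_circlePt_mem hρ.1.le hρ.2 t))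
    · filter_upwards [hbd] with t ⟨c, hc, ht⟩
      have := ht.max (tendsto_const_nhds (x := (1 : ℝ)))
      rwa [max_eq_right hc] at this
  rw [poissonIntegral_const _ hz] at hlim
  have hfz : Tendsto (fun ρ : ℝ => ‖f (ρ * z)‖) (nhdsWithin 1 (Iio 1)) (nhds ‖f z‖) := by
    have hfz : ContinuousAt f (((1 : ℝ) : ℂ) * z) := by
      simpa using (hf.differentiableAt (isOpen_unitDisk.mem_nhds hz)).continuousAt
    have h := (ContinuousAt.comp (f := fun ρ : ℝ => (ρ : ℂ) * z) hfz (by fun_prop)).norm.tendsto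
    simp only [Function.comp_apply, Complex.ofReal_one, one_mul] at h
    exact h.mono_left nhdsWithin_le_nhds
  refine le_of_tendsto_of_tendsto hfz hlim ?_
  filter_upwards [eventually_nhdsLT_one zero_lt_one] with ρ hρ
  refine (norm_le_poissonIntegral (diffContOnCl_dilate hf hρ.1.le hρ.2) hz).trans ?_
  refine poissonIntegral_mono (ContinuousOn.circleIntegrable zero_le_one (hcont hρ.1 hρ.2).norm)
    (ContinuousOn.circleIntegrable zero_le_one ((hcont hρ.1 hρ.2).norm.sup continuousOn_const))
    (Eventually.of_forall fun t => le_max_left _ _) hz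

/-- The outer function with boundary modulus `exp ψ`. -/
def outerFn (ψ : ℂ → ℝ) (z : ℂ) : ℂ :=
  Complex.exp (Real.circleAverage (fun ζ => herglotzRieszKernel 0 z ζ • (ψ ζ : ℂ)) 0 1)

lemma outerFn_ne_zero (ψ : ℂ → ℝ) (z : ℂ) : outerFn ψ z ≠ 0 := Complex.exp_ne_zero _

lemma differentiableOn_outerFn {ψ : ℂ → ℝ} (hψ : CircleIntegrable ψ 0 1) :
    DifferentiableOn ℂ (outerFn ψ) unitDisk := by
  have h : CircleIntegrable (fun ζ => (ψ ζ : ℂ)) 0 1 := by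
    rw [circleIntegrable_iff_integrableOn_circleSet] at hψ ⊢
    exact hψ.ofReal
  rw [unitDisk_eq_ball]
  exact (differentiableOn_circleAverage_herglotzRieszKernel_smul h).cexp

lemma norm_outerFn {ψ : ℂ → ℝ} (hψ : CircleIntegrable ψ 0 1) {z : ℂ} (hz : z ∈ unitDisk) :
    ‖outerFn ψ z‖ = Real.exp (poissonIntegral ψ z) := by
  rw [outerFn, Complex.norm_exp, re_circleAverage_herglotzRieszKernel_smul hψ
    (mem_unitDisk_iff.1 hz), poissonIntegral, poissonKernel_eq_re_herglotzRieszKernel]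

lemma ae_tendsto_norm_outerFn {ψ : ℂ → ℝ} (hψ : CircleIntegrable ψ 0 1) :
    ∀ᵐ θ : ℝ, Tendsto (fun r : ℝ => ‖outerFn ψ (r * circlePt θ)‖) (nhdsWithin 1 (Iio 1))
      (nhds (Real.exp (ψ (circlePt θ)))) := by
  filter_upwards [ae_tendsto_circleAverage_poissonKernel hψ] with θ hθ
  refine ((Real.continuous_exp.tendsto _).comp hθ).congr' ?_
  filter_upwards [eventually_nhdsLT_one zero_lt_one] with r hr
  exact (norm_outerFn hψ (ofReal_mul_circlePt_mem hr.1.le hr.2 θ)).symm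

/-- A bounded analytic function is dominated by the outer function with larger boundary modulus. -/
theorem norm_le_norm_outerFn {f : ℂ → ℂ} {C : ℝ} (hf : DifferentiableOn ℂ f unitDisk)
    (hC : ∀ z ∈ unitDisk, ‖f z‖ ≤ C) {ψ : ℂ → ℝ} (hψ : CircleIntegrable ψ 0 1)
    (hbd : ∀ᵐ t ∂(volume.restrict circleSet), ∃ w, RadLim f t w ∧ ‖w‖ ≤ Real.exp (ψ (circlePt t)))
    {z : ℂ} (hz : z ∈ unitDisk) : ‖f z‖ ≤ ‖outerFn ψ z‖ := by
  have hψI := circleIntegrable_iff_integrableOn_circleSet.1 hψ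
  have hn (n : ℕ) : CircleIntegrable (fun ζ => max (ψ ζ) (-n)) 0 1 := by
    rw [circleIntegrable_iff_integrableOn_circleSet]
    refine hψI.sup ?_
    exact (circleIntegrable_iff_integrableOn_circleSet (g := fun _ => (-n : ℝ))).1
      (circleIntegrable_const _ _ _)
  have hstep (n : ℕ) : ‖f z‖ ≤ Real.exp (poissonIntegral (fun ζ => max (ψ ζ) (-n)) z) := by
    set O := outerFn (fun ζ => max (ψ ζ) (-n)) with hO
    have hOd : DifferentiableOn ℂ O unitDisk := differentiableOn_outerFn (hn n)
    have hO0 : ∀ w, O w ≠ 0 := outerFn_ne_zero _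
    have hlow : ∀ w ∈ unitDisk, Real.exp (-n) ≤ ‖O w‖ := by
      intro w hw
      rw [hO, norm_outerFn (hn n) hw, Real.exp_le_exp]
      exact (poissonIntegral_const (-n : ℝ) hw).ge.trans
        (poissonIntegral_mono (circleIntegrable_const _ _ _) (hn n)
          (Eventually.of_forall fun t => le_max_right _ _) hw)
    have h := norm_le_one_of_radial (f := fun w => f w / O w) (C := C / Real.exp (-n))
      (hf.div hOd fun w _ => hO0 w) (fun w hw => ?_) ?_ hz
    · rw [norm_div, div_le_one (norm_pos_iff.2 (hO0 z)), hO, norm_outerFn (hn n) hz] at h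
      exact h
    · rw [norm_div]
      exact div_le_div₀ ((norm_nonneg _).trans (hC w hw)) (hC w hw) (Real.exp_pos _) (hlow w hw)
    · filter_upwards [hbd, ae_restrict_of_ae (ae_tendsto_norm_outerFn (hn n))]
        with t ⟨w, hw, hwb⟩ hOt
      refine ⟨‖w‖ / Real.exp (max (ψ (circlePt t)) (-n)), ?_, ?_⟩
      · rw [div_le_one (Real.exp_pos _)]
        exact hwb.trans (Real.exp_le_exp.2 (le_max_left _ _))
      · simp only [norm_div]
        exact hw.norm.div hOt (Real.exp_pos _).ne'
  have hlim : Tendsto (fun n : ℕ => poissonIntegral (fun ζ => max (ψ ζ) (-n)) z) atTop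
      (nhds (poissonIntegral ψ z)) := by
    refine tendsto_poissonIntegral (B := fun ζ => |ψ ζ|) ?_ (Eventually.of_forall hn) ?_ ?_ hz
    · rw [circleIntegrable_iff_integrableOn_circleSet]
      exact hψI.abs
    · refine Eventually.of_forall fun n t => ?_
      rw [abs_le]
      constructor
      · exact (neg_abs_le _).trans (le_max_left _ _)
      · exact max_le (le_abs_self _)
          ((neg_nonpos.2 (Nat.cast_nonneg n)).trans (abs_nonneg _))
    · refine Eventually.of_forall fun t => tendsto_const_nhds.congr' ?_
      filter_upwards [eventually_ge_atTop ⌈|ψ (circlePt t)|⌉₊] with n hn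
      refine (max_eq_left ?_).symm
      have := Nat.ceil_le.1 hn
      linarith [neg_abs_le (ψ (circlePt t))]
  rw [norm_outerFn hψ hz]
  exact ge_of_tendsto' ((Real.continuous_exp.tendsto _).comp hlim) hstep

/-- The radial boundary function of a function on the disk. -/
def bdryFn (f : ℂ → ℂ) (ζ : ℂ) : ℂ := limUnder (nhdsWithin 1 (Iio 1)) fun r : ℝ => f (r * ζ)

lemma RadLim.bdryFn_eq {f : ℂ → ℂ} {θ : ℝ} {w : ℂ} (h : RadLim f θ w) :
    bdryFn f (circlePt θ) = w :=
  Tendsto.limUnder_eq h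

lemma RadLim.unique {f : ℂ → ℂ} {θ : ℝ} {w v : ℂ} (hw : RadLim f θ w) (hv : RadLim f θ v) :
    w = v :=
  tendsto_nhds_unique hw hv

lemma ae_radLim_bdryFn {f : ℂ → ℂ} {C : ℝ} (hf : DifferentiableOn ℂ f unitDisk)
    (hC : ∀ z ∈ unitDisk, ‖f z‖ ≤ C) : ∀ᵐ θ : ℝ, RadLim f θ (bdryFn f (circlePt θ)) := by
  filter_upwards [ae_exists_radLim hf hC] with θ ⟨w, hw⟩
  rwa [hw.bdryFn_eq]

lemma RadLim.norm_le {f : ℂ → ℂ} {C : ℝ} (hC : ∀ z ∈ unitDisk, ‖f z‖ ≤ C) {θ : ℝ} {w : ℂ}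
    (h : RadLim f θ w) : ‖w‖ ≤ C := by
  refine le_of_tendsto (Tendsto.norm h) ?_
  filter_upwards [eventually_nhdsLT_one zero_lt_one] with r hr
  exact hC _ (ofReal_mul_circlePt_mem hr.1.le hr.2 θ)

lemma aestronglyMeasurable_bdryFn {f : ℂ → ℂ} {C : ℝ} (hf : DifferentiableOn ℂ f unitDisk)
    (hC : ∀ z ∈ unitDisk, ‖f z‖ ≤ C) :
    AEStronglyMeasurable (fun θ => bdryFn f (circlePt θ)) := by
  have hcp := continuous_circlePt
  obtain ⟨u, -, hu1, hu⟩ := exists_seq_strictMono_tendsto' (zero_lt_one : (0 : ℝ) < 1)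
  refine aestronglyMeasurable_of_tendsto_ae atTop (f := fun n θ => f (u n * circlePt θ))
    (fun n => ?_) ?_
  · exact (hf.continuousOn.comp_continuous (by fun_prop)
      fun θ => ofReal_mul_circlePt_mem (hu1 n).1.le (hu1 n).2 θ).aestronglyMeasurable
  · filter_upwards [ae_radLim_bdryFn hf hC] with θ hθ
    refine Tendsto.comp (g := fun r : ℝ => f (r * circlePt θ)) hθ (tendsto_nhdsWithin_iff.2 ⟨hu, Eventually.of_forall fun n => ?_⟩)
    exact (hu1 n).2

lemma le_poissonKernel_circlePt {z : ℂ} (hz : z ∈ unitDisk) (t : ℝ) :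
    (1 - ‖z‖ ^ 2) / (1 + ‖z‖) ^ 2 ≤ poissonKernel 0 z (circlePt t) := by
  have hz1 : ‖z‖ < 1 := hz
  rw [poissonKernel_eq_polarPoisson, polarPoisson]
  refine div_le_div_of_nonneg_left (by nlinarith [norm_nonneg z])
    (polarPoisson_denom_pos (norm_nonneg z) hz1 _) ?_
  nlinarith [mul_nonneg (norm_nonneg z)
    (by linarith [Real.neg_one_le_cos (t - z.arg)] : 0 ≤ 1 + Real.cos (t - z.arg))]

/-- A nonzero contractive analytic function has nonzero boundary values a.e., and the logarithm
of its boundary modulus is integrable. -/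
theorem ae_bdryFn_ne_zero_and_log_integrable {f : ℂ → ℂ} (hf : DifferentiableOn ℂ f unitDisk)
    (hC : ∀ z ∈ unitDisk, ‖f z‖ ≤ 1) (h0 : ∃ z ∈ unitDisk, f z ≠ 0) :
    (∀ᵐ t ∂(volume.restrict circleSet), bdryFn f (circlePt t) ≠ 0) ∧
      CircleIntegrable (fun ζ => Real.log ‖bdryFn f ζ‖) 0 1 := by
  obtain ⟨z, hz, hfz⟩ := h0
  set b : ℝ → ℂ := fun t => bdryFn f (circlePt t) with hb
  have hrad : ∀ᵐ t ∂(volume.restrict circleSet), RadLim f t (b t) :=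
    ae_restrict_of_ae (ae_radLim_bdryFn hf hC)
  have hbm : AEStronglyMeasurable b (volume.restrict circleSet) :=
    (aestronglyMeasurable_bdryFn hf hC).restrict
  have hb1 : ∀ᵐ t ∂(volume.restrict circleSet), ‖b t‖ ≤ 1 := by
    filter_upwards [hrad] with t ht using RadLim.norm_le hC ht
  set ψ : ℕ → ℂ → ℝ := fun n ζ => Real.log (max ‖bdryFn f ζ‖ (Real.exp (-n))) with hψ
  have hexp (n : ℕ) (ζ : ℂ) : Real.exp (ψ n ζ) = max ‖bdryFn f ζ‖ (Real.exp (-n)) :=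
    Real.exp_log (lt_max_of_lt_right (Real.exp_pos _))
  have hlow (n : ℕ) (ζ : ℂ) : -(n : ℝ) ≤ ψ n ζ := by
    rw [← Real.exp_le_exp, hexp]
    exact le_max_right _ _
  have hup (n : ℕ) : ∀ᵐ t ∂(volume.restrict circleSet), ψ n (circlePt t) ≤ 0 := by
    filter_upwards [hb1] with t ht
    rw [← Real.exp_le_exp, hexp, Real.exp_zero]
    exact max_le ht (Real.exp_le_one_iff.2 (by simp))
  have hm (n : ℕ) : AEStronglyMeasurable (fun t => ψ n (circlePt t))
      (volume.restrict circleSet) :=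
    (Real.measurable_log.comp_aemeasurable
      (hbm.norm.aemeasurable.max aemeasurable_const)).aestronglyMeasurable
  have : IsFiniteMeasure (volume.restrict circleSet) := by
    unfold circleSet; infer_instance
  have hint (n : ℕ) : IntegrableOn (fun t => ψ n (circlePt t)) circleSet := by
    refine Integrable.of_bound (hm n) n ?_
    filter_upwards [hup n] with t ht
    rw [Real.norm_of_nonpos ht]
    linarith [hlow n (circlePt t)]
  have hci (n : ℕ) : CircleIntegrable (ψ n) 0 1 :=
    circleIntegrable_iff_integrableOn_circleSet.2 (hint n)
  set k := (1 - ‖z‖ ^ 2) / (1 + ‖z‖) ^ 2 with hk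
  have hz1 : ‖z‖ < 1 := hz
  have hk0 : 0 < k := div_pos (by nlinarith [norm_nonneg z]) (by positivity)
  have hbound (n : ℕ) : ∫ t in circleSet, -ψ n (circlePt t) ≤
      -(2 * Real.pi * Real.log ‖f z‖) / k := by
    have h1 : ‖f z‖ ≤ Real.exp (poissonIntegral (ψ n) z) := by
      rw [← norm_outerFn (hci n) hz]
      refine norm_le_norm_outerFn hf hC (hci n) ?_ hz
      filter_upwards [hrad] with t ht
      exact ⟨b t, ht, by rw [hexp]; exact le_max_left _ _⟩
    rw [← Real.log_le_iff_le_exp (norm_pos_iff.2 hfz), poissonIntegral_eq] at h1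
    have h2 : ∫ t in circleSet, poissonKernel 0 z (circlePt t) * ψ n (circlePt t) ≤
        ∫ t in circleSet, k * ψ n (circlePt t) := by
      refine integral_mono_ae (integrableOn_poissonKernel_mul (hci n) hz)
        ((hint n).const_mul k) ?_
      filter_upwards [hup n] with t ht
      exact mul_le_mul_of_nonpos_right (le_poissonKernel_circlePt hz t) ht
    rw [integral_const_mul] at h2
    rw [integral_neg, le_div_iff₀ hk0]
    have h3 := mul_le_mul_of_nonneg_left h1 Real.two_pi_pos.le
    rw [mul_inv_cancel_left₀ Real.two_pi_pos.ne'] at h3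
    linarith
  have hmono : ∀ t, Monotone fun n => ENNReal.ofReal (-ψ n (circlePt t)) := by
    intro t m n hmn
    refine ENNReal.ofReal_le_ofReal (neg_le_neg ?_)
    rw [← Real.exp_le_exp, hexp, hexp]
    exact max_le_max_left _ (Real.exp_le_exp.2 (by simpa using hmn))
  have hme (n : ℕ) : AEMeasurable (fun t => ENNReal.ofReal (-ψ n (circlePt t)))
      (volume.restrict circleSet) := (hm n).aemeasurable.neg.ennreal_ofReal
  have hfin : ∫⁻ t in circleSet, ⨆ n, ENNReal.ofReal (-ψ n (circlePt t)) < ⊤ := by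
    rw [lintegral_iSup' hme (Eventually.of_forall hmono)]
    refine (iSup_le fun n => ?_).trans_lt
      (ENNReal.ofReal_lt_top (r := -(2 * Real.pi * Real.log ‖f z‖) / k))
    rw [← ofReal_integral_eq_lintegral_ofReal (f := fun t => -ψ n (circlePt t)) (hint n).neg]
    · exact ENNReal.ofReal_le_ofReal (hbound n)
    · filter_upwards [hup n] with t ht using neg_nonneg.2 ht
  have hne : ∀ᵐ t ∂(volume.restrict circleSet), b t ≠ 0 := by
    filter_upwards [ae_lt_top' (AEMeasurable.iSup hme) hfin.ne] with t ht hbt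
    refine ht.ne (ENNReal.eq_top_of_forall_nnreal_le fun r => ?_)
    obtain ⟨n, hn⟩ := exists_nat_ge (r : ℝ)
    refine le_trans ?_ (le_iSup _ n)
    have : ψ n (circlePt t) = -n := by
      have hbt' : bdryFn f (circlePt t) = 0 := hbt
      simp [hψ, hbt', (Real.exp_pos _).le]
    rw [this, neg_neg]
    rw [ENNReal.le_ofReal_iff_toReal_le (by simp) (by positivity)]
    exact hn
  refine ⟨hne, circleIntegrable_iff_integrableOn_circleSet.2 ⟨?_, ?_⟩⟩
  · exact (Real.measurable_log.comp_aemeasurable hbm.norm.aemeasurable).aestronglyMeasurable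
  · refine lt_of_le_of_lt (lintegral_mono_ae ?_) hfin
    filter_upwards [hne, hb1] with t ht ht1
    obtain ⟨n, hn⟩ := exists_nat_ge (-Real.log ‖b t‖)
    refine le_trans ?_ (le_iSup _ n)
    have hle : Real.exp (-n) ≤ ‖b t‖ := by
      rw [← Real.le_log_iff_exp_le (norm_pos_iff.2 ht)]
      linarith
    have : ψ n (circlePt t) = Real.log ‖b t‖ := by
      simp only [hψ]
      rw [max_eq_left hle]
    rw [this, ← ofReal_norm, Real.norm_of_nonpos]
    exact Real.log_nonpos (norm_nonneg _) ht1

/-- Reflection in the unit circle of a contractive analytic function on the exterior disk. -/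
lemma exists_reflection {f : ℂ → ℂ} (hf : DifferentiableOn ℂ f extDisk)
    (hC : ∀ z ∈ extDisk, ‖f z‖ ≤ 1) :
    ∃ g, SchurFn g ∧ ∀ z ∈ unitDisk, z ≠ 0 →
      g z = (starRingEnd ℂ) (f ((starRingEnd ℂ) z)⁻¹) := by
  set g₀ : ℂ → ℂ := fun z => (starRingEnd ℂ) (f ((starRingEnd ℂ) z)⁻¹) with hg₀
  have hmem {z : ℂ} (hz : z ∈ unitDisk) (h0 : z ≠ 0) : ((starRingEnd ℂ) z)⁻¹ ∈ extDisk := by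
    rw [extDisk, mem_ofPred_eq, norm_inv, Complex.norm_conj]
    exact (one_lt_inv₀ (norm_pos_iff.2 h0)).2 hz
  have hopen : IsOpen extDisk := isOpen_lt continuous_const continuous_norm
  have hb {z : ℂ} (hz : z ∈ unitDisk) (h0 : z ≠ 0) : ‖g₀ z‖ ≤ 1 := by
    rw [hg₀, Complex.norm_conj]
    exact hC _ (hmem hz h0)
  have hd : DifferentiableOn ℂ g₀ (unitDisk \ {0}) := by
    rintro z ⟨hz, h0⟩
    have h1 : DifferentiableAt ℂ (fun z => f z⁻¹) ((starRingEnd ℂ) z) :=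
      DifferentiableAt.comp _ (hf.differentiableAt (hopen.mem_nhds (hmem hz h0)))
        (differentiableAt_inv ((map_ne_zero _).2 h0))
    have h2 := h1.conj_conj
    rw [Complex.conj_conj] at h2
    exact h2.differentiableWithinAt
  have h0m : unitDisk ∈ nhds (0 : ℂ) := isOpen_unitDisk.mem_nhds (by simp [unitDisk])
  have hu : DifferentiableOn ℂ
      (Function.update g₀ 0 (limUnder (nhdsWithin 0 {0}ᶜ) g₀)) unitDisk := by
    refine differentiableOn_update_limUnder_of_bddAbove h0m hd ⟨1, ?_⟩
    rintro _ ⟨z, ⟨hz, h0⟩, rfl⟩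
    exact hb hz h0
  refine ⟨_, ⟨hu, ?_⟩, fun z _ h0 => ?_⟩
  · intro z hz
    by_cases h0 : z = 0
    · subst h0
      have hlim := continuousAt_update_same.1 (hu.differentiableAt h0m).continuousAt
      rw [Function.update_self]
      refine le_of_tendsto hlim.norm ?_
      filter_upwards [self_mem_nhdsWithin, mem_nhdsWithin_of_mem_nhds h0m] with z h0 hz
      exact hb hz h0
    · rw [Function.update_of_ne h0]
      exact hb hz h0
  · rw [Function.update_of_ne h0]

lemma inv_conj_ofReal_mul_circlePt (r θ : ℝ) :
    ((starRingEnd ℂ) (r * circlePt θ))⁻¹ = ((r⁻¹ : ℝ) : ℂ) * circlePt θ := by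
  have h : (starRingEnd ℂ) (circlePt θ) = (circlePt θ)⁻¹ :=
    (Complex.inv_eq_conj (norm_circlePt θ)).symm
  rw [map_mul, Complex.conj_ofReal, h, mul_inv, inv_inv, Complex.ofReal_inv]

/-- A pseudocontinuation of bounded type, expressed through functions on the disk. -/
lemma PCArc.exists_schurFn {s : ℂ → ℂ} {γ : Set ℝ} (hpc : PCArc s γ) (hγ : γ ⊆ circleSet) :
    ∃ g₁ g₂ : ℂ → ℂ, SchurFn g₁ ∧ SchurFn g₂ ∧ (∃ z ∈ unitDisk, g₂ z ≠ 0) ∧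
      ∀ᵐ θ ∂(volume.restrict γ), ∃ w, RadLim s θ w ∧
        bdryFn g₁ (circlePt θ) = (starRingEnd ℂ) w * bdryFn g₂ (circlePt θ) := by
  obtain ⟨ft, ⟨f₁, f₂, hf₁, hf₂, hb₁, hb₂, ⟨z₀, hz₀, hne⟩, hft⟩, hlim⟩ := hpc
  obtain ⟨g₁, hg₁, hgf₁⟩ := exists_reflection hf₁ hb₁
  obtain ⟨g₂, hg₂, hgf₂⟩ := exists_reflection hf₂ hb₂
  have hg₂ne : ∃ z ∈ unitDisk, g₂ z ≠ 0 := by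
    have h1 : 1 < ‖z₀‖ := hz₀
    have hz : ((starRingEnd ℂ) z₀)⁻¹ ∈ unitDisk := by
      rw [unitDisk, mem_ofPred_eq, norm_inv, Complex.norm_conj]
      exact inv_lt_one_of_one_lt₀ h1
    have h0 : ((starRingEnd ℂ) z₀)⁻¹ ≠ 0 := by
      rw [← norm_pos_iff, norm_inv, Complex.norm_conj]
      positivity
    refine ⟨_, hz, ?_⟩
    rw [hgf₂ _ hz h0]
    simpa using hne
  refine ⟨g₁, g₂, hg₁, hg₂, hg₂ne, ?_⟩
  have hnz := ae_restrict_of_ae_restrict_of_subset hγ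
    (ae_bdryFn_ne_zero_and_log_integrable hg₂.1 hg₂.2 hg₂ne).1
  filter_upwards [hlim, hnz, ae_restrict_of_ae (ae_radLim_bdryFn hg₁.1 hg₁.2),
    ae_restrict_of_ae (ae_radLim_bdryFn hg₂.1 hg₂.2)] with θ ⟨w, hw, hwt⟩ hb h1 h2
  refine ⟨w, hw, ?_⟩
  have hinv : Tendsto (fun r : ℝ => r⁻¹) (nhdsWithin 1 (Iio 1)) (nhdsWithin 1 (Ioi 1)) := by
    refine tendsto_nhdsWithin_iff.2 ⟨?_, ?_⟩
    · have h := (continuousAt_inv₀ (one_ne_zero (α := ℝ))).tendsto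
      rw [inv_one] at h
      exact h.mono_left nhdsWithin_le_nhds
    · filter_upwards [eventually_nhdsLT_one zero_lt_one] with r hr
      exact (one_lt_inv₀ hr.1).2 hr.2
  have hq := Tendsto.comp (g := fun r : ℝ => ft (r * circlePt θ)) hwt hinv
  have hconj := (Complex.continuous_conj.tendsto w).comp hq
  have hdiv : Tendsto (fun r : ℝ => g₁ (r * circlePt θ) / g₂ (r * circlePt θ))
      (nhdsWithin 1 (Iio 1)) (nhds (bdryFn g₁ (circlePt θ) / bdryFn g₂ (circlePt θ))) :=
    Tendsto.div h1 h2 hb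
  have hev : ∀ᶠ r : ℝ in nhdsWithin 1 (Iio 1), g₂ (r * circlePt θ) ≠ 0 :=
    Tendsto.eventually_ne h2 hb
  rw [← div_eq_iff hb]
  refine tendsto_nhds_unique hdiv (hconj.congr' ?_)
  filter_upwards [hev, eventually_nhdsLT_one zero_lt_one] with r hr2 hr
  have hz := ofReal_mul_circlePt_mem hr.1.le hr.2 θ
  have h0 : (r : ℂ) * circlePt θ ≠ 0 :=
    mul_ne_zero (by exact_mod_cast hr.1.ne') (circlePt_ne_zero θ)
  rw [hgf₂ _ hz h0, inv_conj_ofReal_mul_circlePt] at hr2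
  have hext : ((r⁻¹ : ℝ) : ℂ) * circlePt θ ∈ extDisk := by
    rw [extDisk, mem_ofPred_eq, norm_ofReal_mul_circlePt (inv_nonneg.2 hr.1.le)]
    exact (one_lt_inv₀ hr.1).2 hr.2
  rw [hgf₁ _ hz h0, hgf₂ _ hz h0, inv_conj_ofReal_mul_circlePt, Function.comp_apply,
    Function.comp_apply, hft _ hext ((map_ne_zero _).1 hr2), map_div₀]

lemma injOn_circlePt : InjOn circlePt circleSet := by
  intro t ht u hu h
  have h1 : (fun t : ℝ => Complex.exp (t * I)) t = (fun t : ℝ => Complex.exp (t * I)) u := h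
  simp only [Complex.exp_eq_exp_iff_exists_int] at h1
  obtain ⟨n, hn⟩ := h1
  have h2 : t = u + n * (2 * Real.pi) := by
    have h3 : ((t : ℂ) - (u + n * (2 * Real.pi))) * I = 0 := by
      linear_combination hn
    have h4 := (mul_eq_zero.1 h3).resolve_right I_ne_zero
    have h5 : (t : ℂ) = ((u + n * (2 * Real.pi) : ℝ) : ℂ) := by
      push_cast
      linear_combination h4
    exact_mod_cast h5
  have hpi := Real.pi_pos
  obtain ⟨ht0, ht1⟩ := ht
  obtain ⟨hu0, hu1⟩ := hu
  have hn0 : n = 0 := by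
    have h6 : (n : ℝ) < 1 := by
      by_contra! hge
      nlinarith
    have h7 : (-1 : ℝ) < n := by
      by_contra! hle
      nlinarith
    have h8 : n < 1 := by exact_mod_cast h6
    have h9 : -1 < n := by exact_mod_cast h7
    omega
  simpa [hn0] using h2

lemma indicator_image_circlePt {γ : Set ℝ} (hγ : γ ⊆ circleSet) (p : ℂ → ℝ) {t : ℝ}
    (ht : t ∈ circleSet) :
    (circlePt '' γ).indicator p (circlePt t) = γ.indicator (fun t => p (circlePt t)) t := by
  by_cases h : t ∈ γ
  · rw [indicator_of_mem h, indicator_of_mem (mem_image_of_mem _ h)]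
  · rw [indicator_of_notMem h, indicator_of_notMem]
    exact fun h' => h ((injOn_circlePt.mem_image_iff hγ ht).1 h')

lemma CircleIntegrable.indicator_image_circlePt {γ : Set ℝ} (hγm : MeasurableSet γ)
    (hγ : γ ⊆ circleSet) {p : ℂ → ℝ} (hp : CircleIntegrable p 0 1) :
    CircleIntegrable ((circlePt '' γ).indicator p) 0 1 := by
  rw [circleIntegrable_iff_integrableOn_circleSet] at hp ⊢
  refine (Integrable.indicator hp hγm).congr ?_
  filter_upwards [ae_restrict_mem (show MeasurableSet circleSet from measurableSet_Ioc)] with t ht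
  exact (_root_.indicator_image_circlePt hγ p ht).symm

lemma conjTranspose_mul_self_eq_one_of_norm {x a y w : ℂ} (hx : ‖x‖ = ‖w‖)
    (ha : ‖a‖ ^ 2 = 1 - ‖w‖ ^ 2) (hy : ‖y‖ = ‖a‖)
    (h : x * (starRingEnd ℂ) a = -((starRingEnd ℂ) w * y)) :
    (!![x, a; y, w])ᴴ * !![x, a; y, w] = 1 := by
  have hx' : (starRingEnd ℂ) x * x = ((‖w‖ ^ 2 : ℝ) : ℂ) := by
    rw [Complex.conj_mul', hx]; push_cast; rfl
  have hw' : (starRingEnd ℂ) w * w = ((‖w‖ ^ 2 : ℝ) : ℂ) := by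
    rw [Complex.conj_mul']; push_cast; rfl
  have ha' : (starRingEnd ℂ) a * a = ((1 - ‖w‖ ^ 2 : ℝ) : ℂ) := by
    rw [Complex.conj_mul', ← ha]; push_cast; rfl
  have hy' : (starRingEnd ℂ) y * y = ((1 - ‖w‖ ^ 2 : ℝ) : ℂ) := by
    rw [Complex.conj_mul', hy, ← ha]; push_cast; rfl
  have h' := congrArg (starRingEnd ℂ) h
  simp only [map_mul, map_neg, Complex.conj_conj] at h'
  push_cast at hx' hw' ha' hy'
  ext i j
  fin_cases i <;> fin_cases j <;>
    simp [Matrix.mul_apply, Fin.sum_univ_two, Matrix.conjTranspose_apply]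
  · linear_combination hx' + hy'
  · linear_combination h'
  · linear_combination h
  · linear_combination ha' + hw'

lemma schurFn_const {c : ℂ} (hc : ‖c‖ ≤ 1) : SchurFn fun _ => c :=
  ⟨differentiableOn_const _, fun _ _ => hc⟩

lemma radLim_const (c : ℂ) (θ : ℝ) : RadLim (fun _ => c) θ c := tendsto_const_nhds

lemma RadLim.congr {f g : ℂ → ℂ} {θ : ℝ} {w : ℂ} (h : RadLim f θ w) (hfg : EqOn f g unitDisk) :
    RadLim g θ w := by
  refine Tendsto.congr' ?_ h
  filter_upwards [eventually_nhdsLT_one zero_lt_one] with r hr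
  exact hfg (ofReal_mul_circlePt_mem hr.1.le hr.2 θ)

/-- Unitary embedding when the determinant-type function `g₂ - s * g₁` vanishes identically. -/
lemma exists_unitary_embedding_of_eqOn_zero {s g₁ g₂ : ℂ → ℂ} {γ : Set ℝ} (hγ : γ ⊆ circleSet)
    (hs : SchurFn s) (hg₁ : SchurFn g₁) (hg₂ : SchurFn g₂) (hne : ∃ z ∈ unitDisk, g₂ z ≠ 0)
    (hrel : ∀ᵐ θ ∂(volume.restrict γ), ∃ w, RadLim s θ w ∧
      bdryFn g₁ (circlePt θ) = (starRingEnd ℂ) w * bdryFn g₂ (circlePt θ))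
    (h0 : ∀ z ∈ unitDisk, g₂ z - s z * g₁ z = 0) :
    ∃ S : ℂ → Matrix (Fin 2) (Fin 2) ℂ,
      (∀ i j, SchurFn fun z => S z i j) ∧ (∀ z, S z 1 1 = s z) ∧ UnitaryAEOn S γ := by
  refine ⟨fun z => !![1, 0; 0, s z], fun i j => ?_, fun z => by simp, ?_⟩
  · fin_cases i <;> fin_cases j
    · simpa using schurFn_const (c := 1) (by simp)
    · simpa using schurFn_const (c := 0) (by simp)
    · simpa using schurFn_const (c := 0) (by simp)
    · simpa using hs
  have hnz := ae_restrict_of_ae_restrict_of_subset hγ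
    (ae_bdryFn_ne_zero_and_log_integrable hg₂.1 hg₂.2 hne).1
  filter_upwards [hrel, hnz, ae_restrict_of_ae (ae_radLim_bdryFn hg₁.1 hg₁.2),
    ae_restrict_of_ae (ae_radLim_bdryFn hg₂.1 hg₂.2)] with θ ⟨w, hw, hwb⟩ hb h1 h2
  have h3 : RadLim (fun z => g₂ z - s z * g₁ z) θ
      (bdryFn g₂ (circlePt θ) - w * bdryFn g₁ (circlePt θ)) :=
    Tendsto.sub h2 (Tendsto.mul hw h1)
  have h4 := h3.unique ((radLim_const 0 θ).congr fun z hz => (h0 z hz).symm)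
  have hw1 : ‖w‖ = 1 := by
    have h5 : w * (starRingEnd ℂ) w = 1 := by
      refine mul_right_cancel₀ hb ?_
      rw [hwb] at h4
      linear_combination -h4
    rw [Complex.mul_conj'] at h5
    have h6 : ‖w‖ ^ 2 = 1 := by exact_mod_cast h5
    exact (pow_eq_one_iff_of_nonneg (norm_nonneg w) two_ne_zero).1 h6
  refine ⟨!![1, 0; 0, w], fun i j => ?_, ?_⟩
  · fin_cases i <;> fin_cases j
    · simpa using radLim_const 1 θ
    · simpa using radLim_const 0 θ
    · simpa using radLim_const 0 θ
    · simpa using hw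
  · exact conjTranspose_mul_self_eq_one_of_norm (by simp [hw1]) (by simp [hw1]) (by simp) (by simp)

/-- Unitary embedding from a reflected representation of the pseudocontinuation. -/
theorem exists_unitary_embedding_of_ne_zero {s g₁ g₂ : ℂ → ℂ} {γ : Set ℝ}
    (hγm : MeasurableSet γ) (hγ : γ ⊆ circleSet)
    (hs : SchurFn s) (hg₁ : SchurFn g₁) (hg₂ : SchurFn g₂) (hne : ∃ z ∈ unitDisk, g₂ z ≠ 0)
    (hrel : ∀ᵐ θ ∂(volume.restrict γ), ∃ w, RadLim s θ w ∧
      bdryFn g₁ (circlePt θ) = (starRingEnd ℂ) w * bdryFn g₂ (circlePt θ))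
    (h0 : ∃ z ∈ unitDisk, g₂ z - s z * g₁ z ≠ 0) :
    ∃ S : ℂ → Matrix (Fin 2) (Fin 2) ℂ,
      (∀ i j, SchurFn fun z => S z i j) ∧ (∀ z, S z 1 1 = s z) ∧ UnitaryAEOn S γ := by
  have hcs : MeasurableSet circleSet := measurableSet_Ioc
  set h : ℂ → ℂ := fun z => g₂ z - s z * g₁ z with hh
  have hhd : DifferentiableOn ℂ h unitDisk := hg₂.1.sub (hs.1.mul hg₁.1)
  have hh2 : ∀ z ∈ unitDisk, ‖h z‖ ≤ 2 := by
    intro z hz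
    refine (norm_sub_le _ _).trans ?_
    rw [norm_mul]
    have := mul_le_one₀ (hs.2 z hz) (norm_nonneg _) (hg₁.2 z hz)
    linarith [hg₂.2 z hz]
  have hk2 : ∀ z ∈ unitDisk, ‖h z / 2‖ ≤ 1 := by
    intro z hz
    rw [norm_div, Complex.norm_ofNat]
    linarith [hh2 z hz]
  have hkd : DifferentiableOn ℂ (fun z => h z / 2) unitDisk := hhd.div_const 2
  obtain ⟨hbk, hlk⟩ := ae_bdryFn_ne_zero_and_log_integrable hkd hk2
    (h0.imp fun z hz => ⟨hz.1, div_ne_zero hz.2 two_ne_zero⟩)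
  obtain ⟨hb2, hl2⟩ := ae_bdryFn_ne_zero_and_log_integrable hg₂.1 hg₂.2 hne
  set k : ℂ → ℂ := fun z => h z / 2 with hk
  have hnorm {w : ℂ} (hw : ‖w‖ ≤ 1) : 0 ≤ 1 - ‖w‖ ^ 2 := by nlinarith [norm_nonneg w]
  -- The logarithmic boundary moduli of the two outer functions.
  set ψ : ℂ → ℝ := (circlePt '' γ).indicator
    ((fun ζ => Real.log ‖bdryFn g₂ ζ‖) + fun _ => -Real.log 2) + fun _ => Real.log 2 with hψ
  set φ : ℂ → ℝ := (circlePt '' γ).indicator ((1 / 2 : ℝ) •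
    (((fun ζ => Real.log ‖bdryFn k ζ‖) + fun _ => Real.log 2) +
      -(fun ζ => Real.log ‖bdryFn g₂ ζ‖))) with hφ
  have hψi : CircleIntegrable ψ 0 1 :=
    ((hl2.add (circleIntegrable_const _ _ _)).indicator_image_circlePt hγm hγ).add
      (circleIntegrable_const _ _ _)
  have hφi : CircleIntegrable φ 0 1 :=
    (((hlk.add (circleIntegrable_const _ _ _)).add hl2.neg).const_smul
      (a := (1 / 2 : ℝ))).indicator_image_circlePt hγm hγ
  have hψφi := hψi.add hφi
  set O := outerFn ψ with hO
  set A := outerFn φ with hA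
  have hO0 : ∀ z, O z ≠ 0 := outerFn_ne_zero ψ
  have hA0 : ∀ z, A z ≠ 0 := outerFn_ne_zero φ
  have hOd : DifferentiableOn ℂ O unitDisk := differentiableOn_outerFn hψi
  have hAd : DifferentiableOn ℂ A unitDisk := differentiableOn_outerFn hφi
  have hin : ∀ᵐ θ, θ ∈ γ → ∃ w, RadLim s θ w ∧
      RadLim g₁ θ ((starRingEnd ℂ) w * bdryFn g₂ (circlePt θ)) ∧
      RadLim g₂ θ (bdryFn g₂ (circlePt θ)) ∧
      RadLim h θ (bdryFn g₂ (circlePt θ) * (1 - ‖w‖ ^ 2 : ℝ)) ∧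
      ‖w‖ ≤ 1 ∧ bdryFn g₂ (circlePt θ) ≠ 0 ∧
      Real.exp (ψ (circlePt θ)) = ‖bdryFn g₂ (circlePt θ)‖ ∧
      Real.exp (φ (circlePt θ)) ^ 2 = 1 - ‖w‖ ^ 2 := by
    filter_upwards [(ae_restrict_iff' hγm).1 hrel, (ae_restrict_iff' hcs).1 hbk,
      (ae_restrict_iff' hcs).1 hb2, ae_radLim_bdryFn hg₁.1 hg₁.2, ae_radLim_bdryFn hg₂.1 hg₂.2,
      ae_radLim_bdryFn hkd hk2] with θ hrelθ hkθ h2θ hr1 hr2 hrk hθ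
    obtain ⟨w, hw, hwb⟩ := hrelθ hθ
    have hk0 := hkθ (hγ hθ)
    have h20 := h2θ (hγ hθ)
    rw [hwb] at hr1
    have hrh : RadLim h θ (bdryFn g₂ (circlePt θ) * (1 - ‖w‖ ^ 2 : ℝ)) := by
      have h3 : RadLim h θ (bdryFn g₂ (circlePt θ) -
          w * ((starRingEnd ℂ) w * bdryFn g₂ (circlePt θ))) :=
        Tendsto.sub hr2 (Tendsto.mul hw hr1)
      convert h3 using 1
      push_cast
      rw [← Complex.mul_conj']
      ring
    have hw1 := RadLim.norm_le hs.2 hw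
    have hbk : bdryFn k (circlePt θ) = bdryFn g₂ (circlePt θ) * (1 - ‖w‖ ^ 2 : ℝ) / 2 :=
      RadLim.bdryFn_eq (Tendsto.div_const hrh 2)
    have hnk : ‖bdryFn k (circlePt θ)‖ = ‖bdryFn g₂ (circlePt θ)‖ * (1 - ‖w‖ ^ 2) / 2 := by
      rw [hbk, norm_div, norm_mul, Complex.norm_ofNat, Complex.norm_real,
        Real.norm_of_nonneg (hnorm hw1)]
    have hpos2 := norm_pos_iff.2 h20
    have hposk := norm_pos_iff.2 hk0
    have hmem : circlePt θ ∈ circlePt '' γ := mem_image_of_mem _ hθ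
    refine ⟨w, hw, hr1, hr2, hrh, hw1, h20, ?_, ?_⟩
    · simp only [hψ, Pi.add_apply, indicator_of_mem hmem, neg_add_cancel_right]
      exact Real.exp_log hpos2
    · rw [← Real.exp_nat_mul]
      simp only [hφ, Pi.add_apply, Pi.neg_apply, Pi.smul_apply, indicator_of_mem hmem,
        smul_eq_mul]
      rw [show ((2 : ℕ) : ℝ) * (1 / 2 * (Real.log ‖bdryFn k (circlePt θ)‖ + Real.log 2 +
        -Real.log ‖bdryFn g₂ (circlePt θ)‖)) = Real.log ‖bdryFn k (circlePt θ)‖ + Real.log 2 -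
        Real.log ‖bdryFn g₂ (circlePt θ)‖ by push_cast; ring, Real.exp_sub, Real.exp_add,
        Real.exp_log hposk, Real.exp_log hpos2, Real.exp_log two_pos, hnk]
      field_simp
  have hout : ∀ θ ∈ circleSet, θ ∉ γ →
      Real.exp (ψ (circlePt θ)) = 2 ∧ φ (circlePt θ) = 0 := by
    intro θ hθ hθγ
    have hnm : circlePt θ ∉ circlePt '' γ := fun h' =>
      hθγ ((injOn_circlePt.mem_image_iff hγ hθ).1 h')
    constructor
    · simp only [hψ, Pi.add_apply, indicator_of_notMem hnm, zero_add]
      exact Real.exp_log two_pos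
    · simp only [hφ, indicator_of_notMem hnm]
  have hexp1 {x y : ℝ} (hx : Real.exp x ^ 2 = 1 - y ^ 2) : Real.exp x ≤ 1 := by
    nlinarith [Real.exp_pos x, sq_nonneg y]
  have hφ0 : ∀ᵐ θ ∂(volume.restrict circleSet), φ (circlePt θ) ≤ 0 := by
    refine (ae_restrict_iff' hcs).2 ?_
    filter_upwards [hin] with θ hθin hθ
    by_cases hθγ : θ ∈ γ
    · obtain ⟨w, -, -, -, -, -, -, -, hφw⟩ := hθin hθγ
      exact Real.exp_le_one_iff.1 (hexp1 hφw)
    · exact (hout θ hθ hθγ).2.le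
  have hAS : SchurFn A := by
    refine ⟨hAd, fun z hz => ?_⟩
    rw [hA, norm_outerFn hφi hz, Real.exp_le_one_iff, ← poissonIntegral_const 0 hz]
    exact poissonIntegral_mono hφi (circleIntegrable_const _ _ _) hφ0 hz
  have hg₁O : ∀ z ∈ unitDisk, ‖g₁ z‖ ≤ ‖O z‖ := by
    intro z hz
    refine norm_le_norm_outerFn hg₁.1 hg₁.2 hψi ((ae_restrict_iff' hcs).2 ?_) hz
    filter_upwards [hin, ae_radLim_bdryFn hg₁.1 hg₁.2] with θ hθin hr hθ
    by_cases hθγ : θ ∈ γ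
    · obtain ⟨w, -, hr1, -, -, hw1, -, hψw, -⟩ := hθin hθγ
      refine ⟨_, hr1, ?_⟩
      rw [hψw, norm_mul, Complex.norm_conj]
      exact mul_le_of_le_one_left (norm_nonneg _) hw1
    · refine ⟨_, hr, (RadLim.norm_le hg₁.2 hr).trans ?_⟩
      rw [(hout θ hθ hθγ).1]
      exact one_le_two
  have hOA : ∀ z ∈ unitDisk, ‖O z * A z‖ = ‖outerFn (ψ + φ) z‖ := by
    intro z hz
    rw [norm_mul, hO, hA, norm_outerFn hψi hz, norm_outerFn hφi hz, norm_outerFn hψφi hz,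
      ← Real.exp_add, poissonIntegral_add hψi hφi hz]
  have hhOA : ∀ z ∈ unitDisk, ‖h z‖ ≤ ‖O z * A z‖ := by
    intro z hz
    rw [hOA z hz]
    refine norm_le_norm_outerFn hhd hh2 hψφi ((ae_restrict_iff' hcs).2 ?_) hz
    filter_upwards [hin, ae_radLim_bdryFn hhd hh2] with θ hθin hr hθ
    rw [Pi.add_apply, Real.exp_add]
    by_cases hθγ : θ ∈ γ
    · obtain ⟨w, -, -, -, hrh, hw1, -, hψw, hφw⟩ := hθin hθγ
      refine ⟨_, hrh, ?_⟩
      rw [hψw, norm_mul, Complex.norm_real, Real.norm_of_nonneg (hnorm hw1), ← hφw, sq]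
      exact mul_le_mul_of_nonneg_left
        (mul_le_of_le_one_left (Real.exp_pos _).le (hexp1 hφw)) (norm_nonneg _)
    · refine ⟨_, hr, (RadLim.norm_le hh2 hr).trans ?_⟩
      rw [(hout θ hθ hθγ).1, (hout θ hθ hθγ).2, Real.exp_zero, mul_one]
  have hs₁₁ : SchurFn fun z => -(g₁ z / O z) := by
    refine ⟨(hg₁.1.div hOd fun z _ => hO0 z).neg, fun z hz => ?_⟩
    rw [norm_neg, norm_div]
    exact div_le_one_of_le₀ (hg₁O z hz) (norm_nonneg _)
  have hs₂₁ : SchurFn fun z => h z / (O z * A z) := by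
    refine ⟨hhd.div (hOd.mul hAd) fun z _ => mul_ne_zero (hO0 z) (hA0 z), fun z hz => ?_⟩
    rw [norm_div]
    exact div_le_one_of_le₀ (hhOA z hz) (norm_nonneg _)
  refine ⟨fun z => !![-(g₁ z / O z), A z; h z / (O z * A z), s z], fun i j => ?_,
    fun z => by simp, (ae_restrict_iff' hγm).2 ?_⟩
  · fin_cases i <;> fin_cases j
    · simpa using hs₁₁
    · simpa using hAS
    · simpa using hs₂₁
    · simpa using hs
  filter_upwards [hin, ae_exists_radLim hs₁₁.1 hs₁₁.2, ae_exists_radLim hAS.1 hAS.2,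
    ae_exists_radLim hs₂₁.1 hs₂₁.2, ae_tendsto_norm_outerFn hψi, ae_tendsto_norm_outerFn hφi]
    with θ hθin ⟨x, hx⟩ ⟨a, ha⟩ ⟨y, hy⟩ hOθ hAθ hθ
  obtain ⟨w, hw, hr1, hr2, hrh, hw1, h20, hψw, hφw⟩ := hθin hθ
  have hpos2 := norm_pos_iff.2 h20
  have hpa : 0 < Real.exp (φ (circlePt θ)) := Real.exp_pos _
  have hna : ‖a‖ = Real.exp (φ (circlePt θ)) := tendsto_nhds_unique ha.norm hAθ
  have hnx : ‖x‖ = ‖w‖ := by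
    have h1 := hx.norm.mul hOθ
    have h2 : ‖x‖ * Real.exp (ψ (circlePt θ)) =
        ‖(starRingEnd ℂ) w * bdryFn g₂ (circlePt θ)‖ := by
      refine tendsto_nhds_unique (h1.congr fun r => ?_) hr1.norm
      rw [← norm_mul, neg_mul, norm_neg, div_mul_cancel₀ _ (hO0 _)]
    rw [hψw, norm_mul, Complex.norm_conj] at h2
    exact mul_right_cancel₀ hpos2.ne' h2
  have hny : ‖y‖ = ‖a‖ := by
    have h1 := hy.norm.mul (hOθ.mul hAθ)
    have h2 : ‖y‖ * (Real.exp (ψ (circlePt θ)) * Real.exp (φ (circlePt θ))) =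
        ‖bdryFn g₂ (circlePt θ) * (1 - ‖w‖ ^ 2 : ℝ)‖ := by
      refine tendsto_nhds_unique (h1.congr fun r => ?_) hrh.norm
      rw [← norm_mul, ← norm_mul, div_mul_cancel₀ _ (mul_ne_zero (hO0 _) (hA0 _))]
    rw [hψw, norm_mul, Complex.norm_real, Real.norm_of_nonneg (hnorm hw1), ← hφw] at h2
    rw [hna]
    refine mul_right_cancel₀ (mul_pos hpos2 hpa).ne' ?_
    linear_combination h2
  have hrot : x * (starRingEnd ℂ) a = -((starRingEnd ℂ) w * y) := by
    have h1 := Tendsto.mul hx hrh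
    have h2 := (Tendsto.mul (Tendsto.mul hr1 hy) ha).neg
    have h3 : x * (bdryFn g₂ (circlePt θ) * (1 - ‖w‖ ^ 2 : ℝ)) =
        -((starRingEnd ℂ) w * bdryFn g₂ (circlePt θ) * y * a) := by
      refine tendsto_nhds_unique h1 (h2.congr fun r => ?_)
      have := hO0 (r * circlePt θ)
      have := hA0 (r * circlePt θ)
      field_simp
    have ha0 : a ≠ 0 := norm_pos_iff.1 (hna ▸ hpa)
    rw [← hφw, ← hna] at h3
    push_cast at h3
    rw [← Complex.mul_conj'] at h3
    refine mul_right_cancel₀ (mul_ne_zero h20 ha0) ?_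
    linear_combination h3
  refine ⟨!![x, a; y, w], fun i j => ?_, ?_⟩
  · fin_cases i <;> fin_cases j
    · simpa using hx
    · simpa using ha
    · simpa using hy
    · simpa using hw
  · exact conjTranspose_mul_self_eq_one_of_norm hnx (by rw [hna, hφw]) hny hrot

/-- a Schur function admitting a pseudocontinuation of bounded type across
an arc `γ` embeds as the (2,2) entry of a 2×2 matrix function with Schur entries whose
boundary values are unitary a.e. on `γ`. -/
theorem statement7 (s : ℂ → ℂ) (γ : Set ℝ) (hγ : IsArc γ)
    (hs : SchurFn s) (hpc : PCArc s γ) :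
    ∃ S : ℂ → Matrix (Fin 2) (Fin 2) ℂ,
      (∀ i j, SchurFn fun z => S z i j) ∧ (∀ z, S z 1 1 = s z) ∧ UnitaryAEOn S γ := by
  obtain ⟨a, b, ha, -, hb, rfl⟩ := hγ
  have hγ : Ioo a b ⊆ circleSet := fun t ht => ⟨ha.trans_lt ht.1, ht.2.le.trans hb⟩
  obtain ⟨g₁, g₂, hg₁, hg₂, hne, hrel⟩ := hpc.exists_schurFn hγ
  by_cases h0 : ∀ z ∈ unitDisk, g₂ z - s z * g₁ z = 0
  · exact exists_unitary_embedding_of_eqOn_zero hγ hs hg₁ hg₂ hne hrel h0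
  · push Not at h0
    exact exists_unitary_embedding_of_ne_zero measurableSet_Ioo hγ hs hg₁ hg₂ hne hrel h0
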